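/- arXiv:2012.14196 — 3 statements merged into one kernel-verified Lean document; each statement's English description precedes it below -/
import Mathlib

section
/- There exists c > 0 such that for every p ∈ ℕ and every u ∈ C_c^∞(ℝ^{2n}, ℂ): (1/p)∫_{ℝ^{2n}} Σ_{j,ℓ=1}^{2n} g^{jℓ}(Z) (i∂_j + pA_j)u(Z) · conj((i∂_ℓ + pA_ℓ)u(Z)) |g(Z)|^{1/2} dZ + ∫_{ℝ^{2n}} V(Z)|u(Z)|² |g(Z)|^{1/2} dZ ≥ (Λ₀ − c·p^{-1/4}) ∫_{ℝ^{2n}} |u(Z)|² |g(Z)|^{1/2} dZ, where Λ₀ = inf_{Z ∈ ℝ^{2n}} (Σ_{j=1}^n a_j(Z) + V(Z)). (This is the semiclassical lower bound λ₀(H_p) ≥ Λ₀ − c·p^{-1/4} for the bottom of the spectrum, stated via the quadratic form of H_p.) -/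
open MeasureTheory Matrix Polynomial

noncomputable section

/-- Complex partial derivative `∂_j u` on `ℝ^{2n}`. -/
def pd {n : ℕ} (j : Fin (2*n)) (u : (Fin (2*n) → ℝ) → ℂ) (Z : Fin (2*n) → ℝ) : ℂ :=
  fderiv ℝ u Z (Pi.single j 1)

/-- Real partial derivative `∂_j f` on `ℝ^{2n}`. -/
def pdR {n : ℕ} (j : Fin (2*n)) (f : (Fin (2*n) → ℝ) → ℝ) (Z : Fin (2*n) → ℝ) : ℝ :=
  fderiv ℝ f Z (Pi.single j 1)

/-- The magnetic derivative `(i∂_j + p A_j)u`. -/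
def mg {n : ℕ} (A : Fin (2*n) → (Fin (2*n) → ℝ) → ℝ) (p : ℕ) (j : Fin (2*n))
    (u : (Fin (2*n) → ℝ) → ℂ) (Z : Fin (2*n) → ℝ) : ℂ :=
  Complex.I * pd j u Z + (p : ℂ) * ((A j Z : ℝ) : ℂ) * u Z

/-- The magnetic field `B_{jk} = ∂_j A_k − ∂_k A_j`. -/
def Bfield {n : ℕ} (A : Fin (2*n) → (Fin (2*n) → ℝ) → ℝ) (Z : Fin (2*n) → ℝ) :
    Matrix (Fin (2*n)) (Fin (2*n)) ℝ :=
  fun j k => pdR j (A k) Z - pdR k (A j) Z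

/-- Smoothing at scale `r` of a bounded, possibly discontinuous map: the result is smooth, its
derivative is `O(r⁻¹)`, and its values are averages of nearby values. -/
theorem exists_smoothing (N : ℕ) (F : Type*) [NormedAddCommGroup F] [NormedSpace ℝ F]
    [FiniteDimensional ℝ F] :
    ∃ D > 0, ∀ (κ : (Fin N → ℝ) → F) (M r : ℝ), 0 < r → (∀ z, ‖κ z‖ ≤ M) →
      ∃ T : (Fin N → ℝ) → F, ContDiff ℝ (⊤ : ℕ∞) T ∧ (∀ z, ‖fderiv ℝ T z‖ ≤ D * M / r) ∧
        ∀ z (s : Set F), Convex ℝ s → IsClosed s → (∀ y, dist y z ≤ r → κ y ∈ s) → T z ∈ s := by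
  classical
  have : CompleteSpace F := FiniteDimensional.complete ℝ F
  let φ : ContDiffBump (0 : Fin N → ℝ) := ⟨1/2, 1, by norm_num, by norm_num⟩
  let f : (Fin N → ℝ) → ℝ := φ.normed volume
  have hf : ContDiff ℝ (⊤ : ℕ∞) f := φ.contDiff_normed
  have hfc : HasCompactSupport f := φ.hasCompactSupport_normed
  have hf0 : ∀ t, 0 ≤ f t := fun t => φ.nonneg_normed t
  have hf1 : ∫ t, f t = 1 := φ.integral_normed
  have hfi : Integrable f := hf.continuous.integrable_of_hasCompactSupport hfc
  have hf' : Continuous (fderiv ℝ f) := hf.continuous_fderiv (by simp)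
  have hf'i : Integrable (fun t => ‖fderiv ℝ f t‖) :=
    (hf'.integrable_of_hasCompactSupport (hfc.fderiv ℝ)).norm
  let L : ℝ →L[ℝ] F →L[ℝ] F := ContinuousLinearMap.lsmul ℝ ℝ
  refine ⟨2 * (∫ t, ‖fderiv ℝ f t‖) + 1, by positivity, fun κ M r hr hM => ?_⟩
  have hM0 : 0 ≤ M := (norm_nonneg _).trans (hM 0)
  let κ' : (Fin N → ℝ) → F := fun w => κ (fun i => r / 2 * (⌊w i⌋ : ℝ))
  have hκ'b : ∀ w, ‖κ' w‖ ≤ M := fun w => hM _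
  have hκ'm : StronglyMeasurable κ' := by
    have h1 : Measurable (fun w : Fin N → ℝ => fun i => ⌊w i⌋) :=
      measurable_pi_lambda _ fun i => Int.measurable_floor.comp (measurable_pi_apply i)
    have h2 : StronglyMeasurable (fun m : Fin N → ℤ => κ (fun i => r / 2 * (m i : ℝ))) :=
      StronglyMeasurable.of_discrete
    exact h2.comp_measurable h1
  have hκ'l : LocallyIntegrable κ' := by
    refine (locallyIntegrable_const M).mono hκ'm.aestronglyMeasurable
      (Filter.Eventually.of_forall fun w => ?_)
    simpa [abs_of_nonneg hM0] using hκ'b w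
  let k : (Fin N → ℝ) → F := convolution f κ' L volume
  have hk : ContDiff ℝ (⊤ : ℕ∞) k := hfc.contDiff_convolution_left L hf hκ'l
  have hk' : ∀ z, ‖fderiv ℝ k z‖ ≤ (∫ t, ‖fderiv ℝ f t‖) * M := by
    intro z
    rw [(hfc.hasFDerivAt_convolution_left L (hf.of_le (by simp)) hκ'l z).fderiv, convolution,
      ← integral_mul_const]
    refine norm_integral_le_of_norm_le (hf'i.mul_const M) (Filter.Eventually.of_forall fun t => ?_)
    refine ContinuousLinearMap.opNorm_le_bound _ (by positivity) fun v => ?_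
    calc ‖(fderiv ℝ f t v) • κ' (z - t)‖ = ‖fderiv ℝ f t v‖ * ‖κ' (z - t)‖ := norm_smul _ _
      _ ≤ (‖fderiv ℝ f t‖ * ‖v‖) * M := by
          gcongr
          · exact ContinuousLinearMap.le_opNorm _ _
          · exact hκ'b _
      _ = _ := by ring
  have hsc : ContDiff ℝ (⊤ : ℕ∞) (fun z : Fin N → ℝ => (2 / r) • z) := contDiff_const_smul _
  refine ⟨fun z => k ((2 / r) • z), hk.comp hsc, fun z => ?_, fun z s hs hsc hy => ?_⟩
  · rw [fderiv_comp_smul, norm_smul, Real.norm_of_nonneg (by positivity)]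
    calc _ ≤ 2 / r * ((∫ t, ‖fderiv ℝ f t‖) * M) := by gcongr; exact hk' _
      _ = 2 * (∫ t, ‖fderiv ℝ f t‖) * M / r := by ring
      _ ≤ _ := by gcongr; linarith
  · have hmeas : Measurable fun t => ENNReal.ofReal (f t) :=
      hf.continuous.measurable.ennreal_ofReal
    let μ : Measure (Fin N → ℝ) := volume.withDensity fun t => ENNReal.ofReal (f t)
    have hμ : IsProbabilityMeasure μ := ⟨by
      rw [withDensity_apply _ MeasurableSet.univ, Measure.restrict_univ,
        ← ofReal_integral_eq_lintegral_ofReal hfi (Filter.Eventually.of_forall hf0), hf1]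
      simp⟩
    have e : k ((2 / r) • z) = ∫ t, κ' ((2 / r) • z - t) ∂μ := by
      rw [integral_withDensity_eq_integral_toReal_smul hmeas
        (Filter.Eventually.of_forall fun _ => ENNReal.ofReal_lt_top)]
      simp only [k, convolution, L, ContinuousLinearMap.lsmul_apply,
        ENNReal.toReal_ofReal (hf0 _)]
    have hcm : StronglyMeasurable fun t => κ' ((2 / r) • z - t) :=
      hκ'm.comp_measurable (measurable_const.sub measurable_id)
    show k ((2 / r) • z) ∈ s
    rw [e]
    refine hs.integral_mem hsc ?_ ?_
    · rw [ae_withDensity_iff hmeas]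
      refine Filter.Eventually.of_forall fun t ht => hy _ ?_
      have hft : f t ≠ 0 := fun h => ht (by simp [h])
      have ht1 : dist t 0 < 1 := by
        have : t ∈ Function.support f := hft
        rw [φ.support_normed_eq] at this
        exact this
      rw [dist_pi_le_iff hr.le]
      intro i
      have hti : |t i| < 1 := by
        have := (dist_pi_lt_iff one_pos).1 ht1 i
        simpa [Real.dist_eq] using this
      have h1 := Int.floor_le (((2 / r) • z - t) i)
      have h2 := Int.lt_floor_add_one (((2 / r) • z - t) i)
      generalize (⌊((2 / r) • z - t) i⌋ : ℝ) = m at h1 h2 ⊢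
      simp only [Pi.sub_apply, Pi.smul_apply, smul_eq_mul] at h1 h2
      rw [abs_lt] at hti
      have hz : z i = r / 2 * (2 / r * z i) := by field_simp
      rw [Real.dist_eq, hz, ← mul_sub, abs_mul, abs_of_pos (by positivity : 0 < r / 2)]
      have : |m - 2 / r * z i| ≤ 2 := by rw [abs_le]; constructor <;> linarith
      nlinarith
    · exact Integrable.of_bound hcm.aestronglyMeasurable M
        (Filter.Eventually.of_forall fun t => hκ'b _)

/-- The purely imaginary Hermitian matrix `iM` attached to a real antisymmetric `M`. -/
theorem isHermitian_I_smul_map {ι : Type*} (M : Matrix ι ι ℝ) (hM : Mᵀ = -M) :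
    (Complex.I • M.map Complex.ofReal).IsHermitian := by
  ext i j
  have : M j i = - M i j := by simpa using congrFun (congrFun hM i) j
  simp [Matrix.conjTranspose_apply, this]

theorem charpoly_I_smul_map {n : ℕ} (M : Matrix (Fin (2 * n)) (Fin (2 * n)) ℝ) (a : Fin n → ℝ)
    (hchar : M.charpoly = ∏ j, (X ^ 2 + C (a j ^ 2))) :
    (Complex.I • M.map Complex.ofReal).charpoly =
      ∏ j, ((X - C (a j : ℂ)) * (X - C (-(a j : ℂ)))) := by
  apply Polynomial.funext
  intro t
  have h1 : (M.map Complex.ofReal).charpoly = ∏ j, (X ^ 2 + C ((a j : ℂ) ^ 2)) := by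
    have := Matrix.charpoly_map M Complex.ofRealHom
    rw [hchar] at this
    have e : M.map Complex.ofReal = M.map Complex.ofRealHom := rfl
    rw [e, this, Polynomial.map_prod]
    simp
  have h2 : Matrix.scalar (Fin (2 * n)) t - Complex.I • M.map Complex.ofReal =
      Complex.I • (Matrix.scalar (Fin (2 * n)) (-Complex.I * t) - M.map Complex.ofReal) := by
    rw [smul_sub]
    congr 1
    ext i j
    by_cases h : i = j
    · subst h; simp [← mul_assoc]
    · simp [h]
  rw [Matrix.eval_charpoly, h2, Matrix.det_smul, ← Matrix.eval_charpoly, h1, Fintype.card_fin,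
    pow_mul, Complex.I_sq, Polynomial.eval_prod, Polynomial.eval_prod]
  have : (-1 : ℂ) ^ n = ∏ _j : Fin n, (-1 : ℂ) := by simp
  rw [this, ← Finset.prod_mul_distrib]
  refine Finset.prod_congr rfl fun j _ => ?_
  simp [mul_pow]
  ring

theorem sum_abs_eigenvalues_I_smul_map {n : ℕ} (M : Matrix (Fin (2 * n)) (Fin (2 * n)) ℝ)
    (a : Fin n → ℝ) (ha : ∀ j, 0 ≤ a j) (hM : Mᵀ = -M)
    (hchar : M.charpoly = ∏ j, (X ^ 2 + C (a j ^ 2))) :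
    ∑ k, |(isHermitian_I_smul_map M hM).eigenvalues k| = 2 * ∑ j, a j := by
  have h := (isHermitian_I_smul_map M hM).roots_charpoly_eq_eigenvalues
  rw [charpoly_I_smul_map M a hchar, Polynomial.roots_prod _ _ (by
    rw [Finset.prod_ne_zero_iff]
    intro j _
    exact mul_ne_zero (X_sub_C_ne_zero _) (X_sub_C_ne_zero _))] at h
  have h2 := congrArg (fun s : Multiset ℂ => (s.map norm).sum) h
  simp only [Multiset.map_map, Multiset.map_bind, Multiset.sum_bind] at h2
  have e : ∀ j, ((X - C (a j : ℂ)) * (X - C (-(a j : ℂ)))).roots = {(a j : ℂ), -(a j : ℂ)} := by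
    intro j
    rw [Polynomial.roots_mul (mul_ne_zero (X_sub_C_ne_zero _) (X_sub_C_ne_zero _)),
      roots_X_sub_C, roots_X_sub_C]
    rfl
  simp only [e] at h2
  rw [Finset.mul_sum]
  calc ∑ k, |(isHermitian_I_smul_map M hM).eigenvalues k| = _ := by
        refine Eq.trans ?_ h2.symm
        simp [Finset.sum]
    _ = _ := by
        refine Finset.sum_congr rfl fun j _ => ?_
        simp [abs_of_nonneg (ha j), two_mul]

open scoped ComplexOrder in
/-- A real antisymmetric matrix `M` is paired with an antisymmetric contraction `N` that realizes
its trace norm. -/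
theorem exists_antisymm_contraction {n : ℕ} (M : Matrix (Fin (2 * n)) (Fin (2 * n)) ℝ)
    (a : Fin n → ℝ) (ha : ∀ j, 0 ≤ a j) (hM : Mᵀ = -M)
    (hchar : M.charpoly = ∏ j, (X ^ 2 + C (a j ^ 2))) :
    ∃ N : Matrix (Fin (2 * n)) (Fin (2 * n)) ℝ, Nᵀ = -N ∧
      (∀ x y, 2 * (x ⬝ᵥ N *ᵥ y) ≤ x ⬝ᵥ x + y ⬝ᵥ y) ∧ (Nᵀ * M).trace = 2 * ∑ j, a j := by
  have hH := isHermitian_I_smul_map M hM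
  set H := Complex.I • M.map Complex.ofReal with hHdef
  set s : Fin (2 * n) → ℂ := fun k => ((SignType.sign (hH.eigenvalues k) : ℝ) : ℂ) with hs
  set U : Matrix (Fin (2 * n)) (Fin (2 * n)) ℂ := hH.eigenvectorUnitary.1 with hU
  have hUU : U * Uᴴ = 1 := Unitary.coe_mul_star_self hH.eigenvectorUnitary
  have hUU' : Uᴴ * U = 1 := Unitary.coe_star_mul_self hH.eigenvectorUnitary
  have hspec : H = U * diagonal (fun k => (hH.eigenvalues k : ℂ)) * Uᴴ := by
    conv_lhs => rw [hH.spectral_theorem, Unitary.conjStarAlgAut_apply]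
    rfl
  set P := U * diagonal s * Uᴴ with hP
  have hsr : ∀ k, |(SignType.sign (hH.eigenvalues k) : ℝ)| ≤ 1 := by
    intro k
    rcases lt_trichotomy (hH.eigenvalues k) 0 with h | h | h <;> simp [h]
  have hPH : Pᴴ = P := by
    rw [hP, conjTranspose_mul, conjTranspose_mul, conjTranspose_conjTranspose,
      diagonal_conjTranspose, mul_assoc]
    congr 3
    ext k
    simp [hs]
  have hHP : (H * P).trace = ((2 * ∑ j, a j : ℝ) : ℂ) := by
    rw [← sum_abs_eigenvalues_I_smul_map M a ha hM hchar, hP]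
    have : H * (U * diagonal s * Uᴴ) =
        U * (diagonal (fun k => (hH.eigenvalues k : ℂ)) * diagonal s) * Uᴴ := by
      conv_lhs => rw [hspec]
      simp only [mul_assoc]
      rw [← mul_assoc Uᴴ U, hUU', one_mul]
    rw [this, trace_mul_comm, ← mul_assoc, hUU', one_mul, diagonal_mul_diagonal, trace_diagonal]
    push_cast
    refine Finset.sum_congr rfl fun k _ => ?_
    simp only [hs]
    rw [← Complex.ofReal_mul, self_mul_sign]
  have hpsd : ∀ ε : ℝ, |ε| = 1 → (1 - (ε : ℂ) • P).PosSemidef := by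
    intro ε hε
    have : (1 - (ε : ℂ) • P) = U * diagonal (fun k => 1 - ε * s k) * Uᴴ := by
      have hd : diagonal (fun k => 1 - ε * s k) = 1 - (ε : ℂ) • diagonal s := by
        rw [← diagonal_one, ← diagonal_smul, diagonal_sub]
        rfl
      rw [hd, mul_sub, sub_mul, mul_one, hUU, hP]
      simp
    rw [this]
    refine PosSemidef.mul_mul_conjTranspose_same (PosSemidef.diagonal fun k => ?_) U
    have h1 : 0 ≤ 1 - ε * (SignType.sign (hH.eigenvalues k) : ℝ) := by
      have h2 : |ε * (SignType.sign (hH.eigenvalues k) : ℝ)| ≤ 1 := by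
        rw [abs_mul, hε, one_mul]
        exact hsr k
      linarith [(abs_le.1 h2).2]
    show (0 : ℂ) ≤ 1 - ε * s k
    simp only [hs]
    exact_mod_cast h1
  refine ⟨P.map Complex.im, ?_, ?_, ?_⟩
  · ext i j
    have : star (P j i) = P i j := congrFun (congrFun hPH i) j
    simp [← this]
  · have key : ∀ ε : ℝ, |ε| = 1 → ∀ x y : Fin (2 * n) → ℝ,
        ε * (x ⬝ᵥ P.map Complex.re *ᵥ x + y ⬝ᵥ P.map Complex.re *ᵥ y
          - 2 * (x ⬝ᵥ P.map Complex.im *ᵥ y)) ≤ x ⬝ᵥ x + y ⬝ᵥ y := by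
      intro ε hε x y
      have h := (hpsd ε hε).re_dotProduct_nonneg (fun k => (x k : ℂ) + Complex.I * y k)
      have him : ∀ i j, (P j i).im = - (P i j).im := by
        intro i j
        have : star (P j i) = P i j := congrFun (congrFun hPH i) j
        simp [← this]
      have hsw : y ⬝ᵥ P.map Complex.im *ᵥ x = -(x ⬝ᵥ P.map Complex.im *ᵥ y) := by
        simp only [dotProduct, mulVec, Finset.mul_sum, map_apply, ← Finset.sum_neg_distrib]
        rw [Finset.sum_comm]
        refine Finset.sum_congr rfl fun i _ => Finset.sum_congr rfl fun j _ => ?_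
        rw [him i j]; ring
      have e : RCLike.re (star (fun k => (x k : ℂ) + Complex.I * y k) ⬝ᵥ
          ((1 - (ε : ℂ) • P) *ᵥ (fun k => (x k : ℂ) + Complex.I * y k))) =
          x ⬝ᵥ x + y ⬝ᵥ y - ε * (x ⬝ᵥ P.map Complex.re *ᵥ x + y ⬝ᵥ P.map Complex.re *ᵥ y
          - (x ⬝ᵥ P.map Complex.im *ᵥ y) + y ⬝ᵥ P.map Complex.im *ᵥ x) := by
        rw [sub_mulVec, one_mulVec, smul_mulVec, dotProduct_sub, dotProduct_smul]
        simp only [dotProduct, mulVec, Finset.mul_sum, map_apply, map_sub, map_sum,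
          ← Finset.sum_add_distrib, ← Finset.sum_sub_distrib, smul_eq_mul]
        refine Finset.sum_congr rfl fun i _ => ?_
        congr 1
        · simp
        · refine Finset.sum_congr rfl fun j _ => ?_
          simp
          exact Or.inl (by ring)
      rw [e, hsw] at h
      linarith
    intro x y
    have h1 := key (-1) (by simp) x y
    have h2 := key 1 (by simp) x (-y)
    simp only [mulVec_neg, dotProduct_neg, neg_dotProduct] at h2
    linarith
  · have := congrArg Complex.re hHP
    rw [Complex.ofReal_re] at this
    rw [← this]
    simp only [trace, diag, Matrix.mul_apply, transpose_apply, map_apply, hHdef, Matrix.smul_apply,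
      Complex.re_sum]
    refine Finset.sum_congr rfl fun i _ => Finset.sum_congr rfl fun j _ => ?_
    have h1 : M j i = - M i j := by simpa using congrFun (congrFun hM i) j
    simp [h1]
    ring

open scoped MatrixOrder Matrix.Norms.L2Operator in
/-- For a positive definite `G` and an antisymmetric `B` whose associated skew endomorphism has
eigenvalues `± i a_j`, there is an antisymmetric bivector `K` of unit `G⁻¹`-norm whose pairing
with `B` is the trace `2 ∑ a_j`. -/
theorem exists_calibrating_bivector {n : ℕ} (G B : Matrix (Fin (2 * n)) (Fin (2 * n)) ℝ)
    (a : Fin n → ℝ) (ha : ∀ j, 0 ≤ a j) (hG : G.PosDef) (hB : Bᵀ = -B)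
    (hchar : (G⁻¹ * B).charpoly = ∏ j, (X ^ 2 + C (a j ^ 2))) :
    ∃ K : Matrix (Fin (2 * n)) (Fin (2 * n)) ℝ, Kᵀ = -K ∧
      (∀ x y, 2 * (x ⬝ᵥ K *ᵥ y) ≤ x ⬝ᵥ G⁻¹ *ᵥ x + y ⬝ᵥ G⁻¹ *ᵥ y) ∧
      (Kᵀ * B).trace = 2 * ∑ j, a j := by
  obtain ⟨S, hS, rfl⟩ : ∃ S : Matrix (Fin (2 * n)) (Fin (2 * n)) ℝ, IsUnit S ∧ G = Sᵀ * S := by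
    obtain ⟨S, hS, h⟩ := CStarAlgebra.isStrictlyPositive_iff_eq_star_mul_self.mp
      (Matrix.isStrictlyPositive_iff_posDef.2 hG)
    exact ⟨S, hS, h⟩
  have hdet : IsUnit S.det := (Matrix.isUnit_iff_isUnit_det S).1 hS
  set R := S⁻¹ with hR
  have hinv : (Sᵀ * S)⁻¹ = R * Rᵀ := by
    rw [Matrix.mul_inv_rev, hR, Matrix.transpose_nonsing_inv]
  rw [hinv] at hchar ⊢
  set M := Rᵀ * B * R with hMd
  have hM : Mᵀ = -M := by
    rw [hMd, transpose_mul, transpose_mul, transpose_transpose, hB, neg_mul, mul_neg, mul_assoc]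
  have hMc : M.charpoly = ∏ j, (X ^ 2 + C (a j ^ 2)) := by
    rw [← hchar, hMd, Matrix.charpoly_mul_comm, mul_assoc]
  obtain ⟨N, hN, hc, htr⟩ := exists_antisymm_contraction M a ha hM hMc
  have hpull : ∀ (P : Matrix (Fin (2 * n)) (Fin (2 * n)) ℝ) (x y : Fin (2 * n) → ℝ),
      x ⬝ᵥ (R * P * Rᵀ) *ᵥ y = (Rᵀ *ᵥ x) ⬝ᵥ P *ᵥ (Rᵀ *ᵥ y) := by
    intro P x y
    rw [← mulVec_mulVec, ← mulVec_mulVec, dotProduct_mulVec, ← mulVec_transpose]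
  refine ⟨R * N * Rᵀ, ?_, fun x y => ?_, ?_⟩
  · rw [transpose_mul, transpose_mul, transpose_transpose, hN, neg_mul, mul_neg, mul_assoc]
  · have h1 := hpull 1
    simp only [mul_one, one_mulVec] at h1
    rw [hpull, h1, h1]
    exact hc _ _
  · rw [← htr, hMd, transpose_mul, transpose_mul, transpose_transpose]
    calc (R * (Nᵀ * Rᵀ) * B).trace = (R * (Nᵀ * Rᵀ * B)).trace := by simp only [mul_assoc]
      _ = _ := by rw [trace_mul_comm]; simp only [mul_assoc]

theorem sum_antisymm_mul {ι : Type*} [Fintype ι] (T S c : ι → ι → ℝ)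
    (hT : ∀ j l, T l j = -T j l) (hS : ∀ j l, S j l - S l j = c j l) :
    ∑ j, ∑ l, T j l * S j l = 1 / 2 * ∑ j, ∑ l, T j l * c j l := by
  have h : ∑ j, ∑ l, T j l * S j l = -∑ j, ∑ l, T j l * S l j := by
    rw [Finset.sum_comm]
    simp only [← Finset.sum_neg_distrib]
    refine Finset.sum_congr rfl fun j _ => Finset.sum_congr rfl fun l _ => ?_
    rw [hT j l]; ring
  have h2 : ∑ j, ∑ l, T j l * c j l = ∑ j, ∑ l, T j l * S j l - ∑ j, ∑ l, T j l * S l j := by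
    simp only [← Finset.sum_sub_distrib, ← hS, mul_sub]
  linarith

section MagneticIdentity

variable {n : ℕ} {A : Fin (2 * n) → (Fin (2 * n) → ℝ) → ℝ} {u : (Fin (2 * n) → ℝ) → ℂ}

theorem pd_re (hu : ContDiff ℝ (⊤ : ℕ∞) u) (j : Fin (2 * n)) (Z : Fin (2 * n) → ℝ) :
    (pd j u Z).re = pdR j (fun Z => (u Z).re) Z := by
  have h := (hu.differentiable (by simp) Z).hasFDerivAt
  have := (Complex.reCLM.hasFDerivAt.comp Z h).fderiv
  simp only [pd, pdR]
  change _ = fderiv ℝ (⇑Complex.reCLM ∘ u) Z _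
  rw [this]
  simp

theorem pd_im (hu : ContDiff ℝ (⊤ : ℕ∞) u) (j : Fin (2 * n)) (Z : Fin (2 * n) → ℝ) :
    (pd j u Z).im = pdR j (fun Z => (u Z).im) Z := by
  have h := (hu.differentiable (by simp) Z).hasFDerivAt
  have := (Complex.imCLM.hasFDerivAt.comp Z h).fderiv
  simp only [pd, pdR]
  change _ = fderiv ℝ (⇑Complex.imCLM ∘ u) Z _
  rw [this]
  simp

theorem mg_re (hu : ContDiff ℝ (⊤ : ℕ∞) u) (p : ℕ) (j : Fin (2 * n)) (Z : Fin (2 * n) → ℝ) :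
    (mg A p j u Z).re = -pdR j (fun Z => (u Z).im) Z + p * A j Z * (u Z).re := by
  simp [mg, ← pd_im hu, mul_assoc]

theorem mg_im (hu : ContDiff ℝ (⊤ : ℕ∞) u) (p : ℕ) (j : Fin (2 * n)) (Z : Fin (2 * n) → ℝ) :
    (mg A p j u Z).im = pdR j (fun Z => (u Z).re) Z + p * A j Z * (u Z).im := by
  simp [mg, ← pd_re hu, mul_assoc]

theorem contDiff_pdR {f : (Fin (2 * n) → ℝ) → ℝ} (hf : ContDiff ℝ (⊤ : ℕ∞) f) (j : Fin (2 * n)) :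
    ContDiff ℝ (⊤ : ℕ∞) (pdR j f) :=
  (hf.fderiv_right (m := (⊤ : ℕ∞)) (by simp)).clm_apply contDiff_const

theorem pdR_pdR_comm {f : (Fin (2 * n) → ℝ) → ℝ} (hf : ContDiff ℝ (⊤ : ℕ∞) f)
    (j l : Fin (2 * n)) (Z : Fin (2 * n) → ℝ) : pdR j (pdR l f) Z = pdR l (pdR j f) Z := by
  have hd : DifferentiableAt ℝ (fderiv ℝ f) Z :=
    (hf.fderiv_right (m := (⊤ : ℕ∞)) (by simp)).differentiable (by simp) Z
  have e : ∀ i k, pdR i (pdR k f) Z =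
      fderiv ℝ (fderiv ℝ f) Z (Pi.single i 1) (Pi.single k 1) := by
    intro i k
    simp only [pdR]
    change fderiv ℝ (fun Z => fderiv ℝ f Z (Pi.single k 1)) Z (Pi.single i 1) = _
    rw [fderiv_clm_apply hd (differentiableAt_const _)]
    simp
  rw [e, e]
  exact (hf.contDiffAt.isSymmSndFDerivAt
    (by
    rw [minSmoothness_of_isRCLikeNormedField]
    exact WithTop.coe_le_coe.2 (le_top : (2 : ℕ∞) ≤ ⊤))) _ _

theorem pdR_mul {f h : (Fin (2 * n) → ℝ) → ℝ} (hf : ContDiff ℝ (⊤ : ℕ∞) f)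
    (hh : ContDiff ℝ (⊤ : ℕ∞) h) (j : Fin (2 * n)) (Z : Fin (2 * n) → ℝ) :
    pdR j (fun Z => f Z * h Z) Z = f Z * pdR j h Z + pdR j f Z * h Z := by
  simp only [pdR]
  rw [fderiv_fun_mul (hf.differentiable (by simp) Z) (hh.differentiable (by simp) Z)]
  simp [mul_comm]

theorem pdR_add {f h : (Fin (2 * n) → ℝ) → ℝ} (hf : ContDiff ℝ (⊤ : ℕ∞) f)
    (hh : ContDiff ℝ (⊤ : ℕ∞) h) (j : Fin (2 * n)) (Z : Fin (2 * n) → ℝ) :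
    pdR j (fun Z => f Z + h Z) Z = pdR j f Z + pdR j h Z := by
  simp only [pdR]
  rw [fderiv_fun_add (hf.differentiable (by simp) Z) (hh.differentiable (by simp) Z)]
  simp

theorem pdR_sub {f h : (Fin (2 * n) → ℝ) → ℝ} (hf : ContDiff ℝ (⊤ : ℕ∞) f)
    (hh : ContDiff ℝ (⊤ : ℕ∞) h) (j : Fin (2 * n)) (Z : Fin (2 * n) → ℝ) :
    pdR j (fun Z => f Z - h Z) Z = pdR j f Z - pdR j h Z := by
  simp only [pdR]
  rw [fderiv_fun_sub (hf.differentiable (by simp) Z) (hh.differentiable (by simp) Z)]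
  simp

/-- The magnetic current `Re (u · conj (D_l u))`. -/
def current (A : Fin (2 * n) → (Fin (2 * n) → ℝ) → ℝ) (p : ℕ) (l : Fin (2 * n))
    (u : (Fin (2 * n) → ℝ) → ℂ) (Z : Fin (2 * n) → ℝ) : ℝ :=
  (u Z * (starRingEnd ℂ) (mg A p l u Z)).re

theorem current_eq (hu : ContDiff ℝ (⊤ : ℕ∞) u) (p : ℕ) (l : Fin (2 * n)) :
    current A p l u = fun Z => ((u Z).im * pdR l (fun Z => (u Z).re) Z
      - (u Z).re * pdR l (fun Z => (u Z).im) Z)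
      + ((p * A l Z) * ((u Z).re * (u Z).re + (u Z).im * (u Z).im)) := by
  funext Z
  simp only [current, Complex.mul_re, Complex.conj_re, Complex.conj_im, mg_re hu, mg_im hu]
  ring

theorem abs_current_le (p : ℕ) (l : Fin (2 * n)) (Z : Fin (2 * n) → ℝ) :
    |current A p l u Z| ≤ ‖u Z‖ * ‖mg A p l u Z‖ := by
  refine (Complex.abs_re_le_norm _).trans ?_
  rw [norm_mul, RCLike.norm_conj]

theorem contDiff_re (hu : ContDiff ℝ (⊤ : ℕ∞) u) : ContDiff ℝ (⊤ : ℕ∞) (fun Z => (u Z).re) :=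
  Complex.reCLM.contDiff.comp hu

theorem contDiff_im (hu : ContDiff ℝ (⊤ : ℕ∞) u) : ContDiff ℝ (⊤ : ℕ∞) (fun Z => (u Z).im) :=
  Complex.imCLM.contDiff.comp hu

theorem contDiff_current (hA : ∀ j, ContDiff ℝ (⊤ : ℕ∞) (A j)) (hu : ContDiff ℝ (⊤ : ℕ∞) u)
    (p : ℕ) (l : Fin (2 * n)) : ContDiff ℝ (⊤ : ℕ∞) (current A p l u) := by
  have h1 := contDiff_re hu
  have h2 := contDiff_im hu
  rw [current_eq hu]
  exact ((h2.mul (contDiff_pdR h1 l)).sub (h1.mul (contDiff_pdR h2 l))).add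
    ((contDiff_const.mul (hA l)).mul ((h1.mul h1).add (h2.mul h2)))

theorem hasCompactSupport_current (hc : HasCompactSupport u) (p : ℕ) (l : Fin (2 * n)) :
    HasCompactSupport (current A p l u) :=
  hc.mono fun Z hZ h => hZ (by simp [current, h])

/-- Pointwise form of the commutator identity `[D_j, D_l] = i p B_{jl}`. -/
theorem sum_antisymm_mul_mg (hA : ∀ j, ContDiff ℝ (⊤ : ℕ∞) (A j)) (hu : ContDiff ℝ (⊤ : ℕ∞) u)
    (p : ℕ) (T : Fin (2 * n) → Fin (2 * n) → ℝ) (hT : ∀ j l, T l j = -T j l)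
    (Z : Fin (2 * n) → ℝ) :
    ∑ j, ∑ l, T j l * (2 * (mg A p j u Z).re * (mg A p l u Z).im + pdR j (current A p l u) Z) =
      p / 2 * (∑ j, ∑ l, T j l * Bfield A Z j l) * ‖u Z‖ ^ 2 := by
  have h1 := contDiff_re hu
  have h2 := contDiff_im hu
  rw [sum_antisymm_mul T _ (fun j l => p * ‖u Z‖ ^ 2 * Bfield A Z j l) hT]
  · rw [Finset.mul_sum, Finset.mul_sum, Finset.sum_mul]
    refine Finset.sum_congr rfl fun j _ => ?_
    rw [Finset.mul_sum, Finset.mul_sum, Finset.sum_mul]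
    exact Finset.sum_congr rfl fun l _ => by ring
  · have hcur : ∀ j l, pdR j (current A p l u) Z =
        ((u Z).im * pdR j (pdR l fun Z => (u Z).re) Z
          + pdR j (fun Z => (u Z).im) Z * pdR l (fun Z => (u Z).re) Z)
        - ((u Z).re * pdR j (pdR l fun Z => (u Z).im) Z
          + pdR j (fun Z => (u Z).re) Z * pdR l (fun Z => (u Z).im) Z)
        + ((p * A l Z) * (2 * (u Z).re * pdR j (fun Z => (u Z).re) Z
            + 2 * (u Z).im * pdR j (fun Z => (u Z).im) Z)
          + (p * pdR j (A l) Z) * ((u Z).re * (u Z).re + (u Z).im * (u Z).im)) := by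
      intro j l
      rw [current_eq hu, pdR_add ((h2.mul (contDiff_pdR h1 l)).sub (h1.mul (contDiff_pdR h2 l)))
        ((contDiff_const.mul (hA l)).mul ((h1.mul h1).add (h2.mul h2))),
        pdR_sub (h2.mul (contDiff_pdR h1 l)) (h1.mul (contDiff_pdR h2 l)),
        pdR_mul h2 (contDiff_pdR h1 l), pdR_mul h1 (contDiff_pdR h2 l),
        pdR_mul (contDiff_const.mul (hA l)) ((h1.mul h1).add (h2.mul h2)),
        pdR_mul contDiff_const (hA l), pdR_add (h1.mul h1) (h2.mul h2), pdR_mul h1 h1,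
        pdR_mul h2 h2]
      have : pdR j (fun _ : Fin (2 * n) → ℝ => (p : ℝ)) Z = 0 := by simp [pdR]
      rw [this]
      ring
    intro j l
    rw [hcur, hcur, pdR_pdR_comm h1 l j, pdR_pdR_comm h2 l j]
    simp only [mg_re hu, mg_im hu, Bfield]
    rw [← Complex.normSq_eq_norm_sq, Complex.normSq_apply]
    ring

theorem integral_mul_pdR {f h : (Fin (2 * n) → ℝ) → ℝ} (hf : ContDiff ℝ (⊤ : ℕ∞) f)
    (hh : ContDiff ℝ (⊤ : ℕ∞) h) (hc : HasCompactSupport h) (j : Fin (2 * n)) :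
    ∫ Z, f Z * pdR j h Z = -∫ Z, pdR j f Z * h Z := by
  have hc' : HasCompactSupport (pdR j h) := hc.fderiv_apply ℝ _
  refine integral_mul_fderiv_eq_neg_fderiv_mul_of_integrable ?_ ?_ ?_
    (fun x _ => hf.differentiable (by simp) x) (fun x _ => hh.differentiable (by simp) x)
  · exact ((contDiff_pdR hf j).continuous.mul hh.continuous).integrable_of_hasCompactSupport
      hc.mul_left
  · exact (hf.continuous.mul (contDiff_pdR hh j).continuous).integrable_of_hasCompactSupport
      hc'.mul_left
  · exact (hf.continuous.mul hh.continuous).integrable_of_hasCompactSupport hc.mul_left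

theorem integral_sum_mul_pdR_current (hA : ∀ j, ContDiff ℝ (⊤ : ℕ∞) (A j))
    (hu : ContDiff ℝ (⊤ : ℕ∞) u) (hc : HasCompactSupport u) (p : ℕ)
    (T : Fin (2 * n) → Fin (2 * n) → (Fin (2 * n) → ℝ) → ℝ)
    (hT : ∀ j l, ContDiff ℝ (⊤ : ℕ∞) (T j l)) :
    Integrable (fun Z => ∑ j, ∑ l, (T j l Z * pdR j (current A p l u) Z
      + pdR j (T j l) Z * current A p l u Z)) ∧
    ∫ Z, ∑ j, ∑ l, (T j l Z * pdR j (current A p l u) Z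
      + pdR j (T j l) Z * current A p l u Z) = 0 := by
  have hcu := contDiff_current hA hu p
  have hcc := hasCompactSupport_current (A := A) hc p
  have hi1 : ∀ j l, Integrable fun Z => T j l Z * pdR j (current A p l u) Z := fun j l =>
    ((hT j l).continuous.mul
      (contDiff_pdR (hcu l) j).continuous).integrable_of_hasCompactSupport
      (HasCompactSupport.mul_left ((hcc l).fderiv_apply ℝ _))
  have hi2 : ∀ j l, Integrable fun Z => pdR j (T j l) Z * current A p l u Z := fun j l =>
    ((contDiff_pdR (hT j l) j).continuous.mul
      (hcu l).continuous).integrable_of_hasCompactSupport (hcc l).mul_left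
  have hi4 : ∀ j l, Integrable fun Z => T j l Z * pdR j (current A p l u) Z
      + pdR j (T j l) Z * current A p l u Z := fun j l => (hi1 j l).add (hi2 j l)
  have hi3 : ∀ j, Integrable fun Z => ∑ l, (T j l Z * pdR j (current A p l u) Z
      + pdR j (T j l) Z * current A p l u Z) := fun j =>
    integrable_finsetSum _ fun l _ => hi4 j l
  refine ⟨integrable_finsetSum _ fun j _ => hi3 j, ?_⟩
  rw [integral_finsetSum _ fun j _ => hi3 j]
  refine Finset.sum_eq_zero fun j _ => ?_
  rw [integral_finsetSum _ fun l _ => hi4 j l]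
  refine Finset.sum_eq_zero fun l _ => ?_
  rw [integral_add (hi1 j l) (hi2 j l), integral_mul_pdR (hT j l) (hcu l) (hcc l)]
  ring

end MagneticIdentity

/-- Bounded and Lipschitz real functions. -/
def BddLip {N : ℕ} (f : (Fin N → ℝ) → ℝ) : Prop :=
  ∃ C, 0 ≤ C ∧ (∀ Z, |f Z| ≤ C) ∧ ∀ Z Y, |f Z - f Y| ≤ C * dist Z Y

namespace BddLip

variable {N : ℕ} {f h : (Fin N → ℝ) → ℝ}

theorem const (c : ℝ) : BddLip fun _ : Fin N → ℝ => c :=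
  ⟨|c|, abs_nonneg _, fun _ => le_rfl, fun Z Y => by simp; positivity⟩

theorem add (hf : BddLip f) (hh : BddLip h) : BddLip fun Z => f Z + h Z := by
  obtain ⟨C, hC, hb, hl⟩ := hf
  obtain ⟨C', hC', hb', hl'⟩ := hh
  refine ⟨C + C', by positivity, fun Z => (abs_add_le _ _).trans (add_le_add (hb Z) (hb' Z)),
    fun Z Y => ?_⟩
  rw [add_mul, add_sub_add_comm]
  exact (abs_add_le _ _).trans (add_le_add (hl Z Y) (hl' Z Y))

theorem mul (hf : BddLip f) (hh : BddLip h) : BddLip fun Z => f Z * h Z := by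
  obtain ⟨C, hC, hb, hl⟩ := hf
  obtain ⟨C', hC', hb', hl'⟩ := hh
  refine ⟨2 * (C * C'), by positivity, fun Z => ?_, fun Z Y => ?_⟩
  · rw [abs_mul]
    nlinarith [mul_le_mul (hb Z) (hb' Z) (abs_nonneg _) hC, mul_nonneg hC hC']
  · have e : f Z * h Z - f Y * h Y = f Z * (h Z - h Y) + (f Z - f Y) * h Y := by ring
    rw [e]
    refine (abs_add_le _ _).trans ?_
    rw [abs_mul, abs_mul]
    have h1 := mul_le_mul (hb Z) (hl' Z Y) (abs_nonneg _) hC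
    have h2 := mul_le_mul (hl Z Y) (hb' Y) (abs_nonneg _) (by positivity)
    linarith

theorem sum {ι : Type*} (s : Finset ι) {f : ι → (Fin N → ℝ) → ℝ} (hf : ∀ i, BddLip (f i)) :
    BddLip fun Z => ∑ i ∈ s, f i Z := by
  classical
  induction s using Finset.induction_on with
  | empty => simpa using const 0
  | insert i s hi ih => simpa [Finset.sum_insert hi] using (hf i).add ih

theorem prod {ι : Type*} (s : Finset ι) {f : ι → (Fin N → ℝ) → ℝ} (hf : ∀ i, BddLip (f i)) :
    BddLip fun Z => ∏ i ∈ s, f i Z := by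
  classical
  induction s using Finset.induction_on with
  | empty => simpa using const 1
  | insert i s hi ih => simpa [Finset.prod_insert hi] using (hf i).mul ih

theorem sub (hf : BddLip f) (hh : BddLip h) : BddLip fun Z => f Z - h Z := by
  simpa [sub_eq_add_neg] using hf.add ((const (-1)).mul hh)

theorem sqrt (hf : BddLip f) {δ : ℝ} (hδ : 0 < δ) (hfδ : ∀ Z, δ ≤ f Z) :
    BddLip fun Z => Real.sqrt (f Z) := by
  obtain ⟨C, hC, hb, hl⟩ := hf
  have hs : 0 < Real.sqrt δ := Real.sqrt_pos.2 hδ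
  refine ⟨Real.sqrt C + C / Real.sqrt δ, by positivity, fun Z => ?_, fun Z Y => ?_⟩
  · rw [abs_of_nonneg (Real.sqrt_nonneg _)]
    exact (Real.sqrt_le_sqrt ((le_abs_self _).trans (hb Z))).trans
      (le_add_of_nonneg_right (by positivity))
  · have hZ := Real.mul_self_sqrt (hδ.le.trans (hfδ Z))
    have hY := Real.mul_self_sqrt (hδ.le.trans (hfδ Y))
    have hZ' := Real.sqrt_le_sqrt (hfδ Z)
    have e : |√(f Z) - √(f Y)| * (√(f Z) + √(f Y)) = |f Z - f Y| := by
      rw [← abs_of_nonneg (by positivity : 0 ≤ √(f Z) + √(f Y)), ← abs_mul, ← hZ, ← hY,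
        Real.sqrt_mul_self (Real.sqrt_nonneg _), Real.sqrt_mul_self (Real.sqrt_nonneg _)]
      congr 1
      ring
    have h1 : |√(f Z) - √(f Y)| * √δ ≤ C * dist Z Y := by
      refine le_trans ?_ (hl Z Y)
      rw [← e]
      gcongr
      exact le_add_of_le_of_nonneg hZ' (Real.sqrt_nonneg _)
    calc |√(f Z) - √(f Y)| ≤ C * dist Z Y / √δ := by rwa [le_div_iff₀ hs]
      _ = C / √δ * dist Z Y := by ring
      _ ≤ _ := by gcongr; exact le_add_of_nonneg_left (Real.sqrt_nonneg _)

theorem continuous (hf : BddLip f) : Continuous f := by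
  obtain ⟨C, hC, -, hl⟩ := hf
  refine (LipschitzWith.of_dist_le_mul (K := ⟨C, hC⟩) fun Z Y => ?_).continuous
  exact hl Z Y

theorem of_iteratedFDeriv (hf : ContDiff ℝ (⊤ : ℕ∞) f)
    (hb : ∀ k : ℕ, ∃ C, ∀ Z, ‖iteratedFDeriv ℝ k f Z‖ ≤ C) : BddLip f := by
  obtain ⟨C₀, h₀⟩ := hb 0
  obtain ⟨C₁, h₁⟩ := hb 1
  simp only [norm_iteratedFDeriv_zero, norm_iteratedFDeriv_one] at h₀ h₁
  have hC₀ : 0 ≤ C₀ := (norm_nonneg _).trans (h₀ 0)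
  have hC₁ : 0 ≤ C₁ := (norm_nonneg _).trans (h₁ 0)
  refine ⟨C₀ + C₁, by positivity, fun Z => (h₀ Z).trans (by linarith), fun Z Y => ?_⟩
  have := convex_univ.norm_image_sub_le_of_norm_fderiv_le (𝕜 := ℝ)
    (fun x _ => hf.differentiable (by simp) x) (fun x _ => h₁ x) (Set.mem_univ Y) (Set.mem_univ Z)
  rw [dist_eq_norm]
  refine this.trans ?_
  gcongr
  linarith

/-- Finitely many bounded Lipschitz functions admit a common constant. -/
theorem exists_common {ι : Type*} [Fintype ι] {f : ι → (Fin N → ℝ) → ℝ}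
    (hf : ∀ i, BddLip (f i)) :
    ∃ C, 0 ≤ C ∧ (∀ i Z, |f i Z| ≤ C) ∧ ∀ i Z Y, |f i Z - f i Y| ≤ C * dist Z Y := by
  choose C hC hb hl using hf
  have h : ∀ i, C i ≤ ∑ i, C i := fun i =>
    Finset.single_le_sum (fun i _ => hC i) (Finset.mem_univ i)
  refine ⟨∑ i, C i, Finset.sum_nonneg fun i _ => hC i, fun i Z => (hb i Z).trans (h i),
    fun i Z Y => (hl i Z Y).trans ?_⟩
  gcongr
  exact h i

end BddLip

section UniformlyElliptic

variable {N : ℕ}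

theorem dotProduct_mulVec_eq_sum (G : Matrix (Fin N) (Fin N) ℝ) (x y : Fin N → ℝ) :
    x ⬝ᵥ G *ᵥ y = ∑ j, ∑ l, G j l * x j * y l := by
  simp only [dotProduct, mulVec, Finset.mul_sum]
  exact Finset.sum_congr rfl fun j _ => Finset.sum_congr rfl fun l _ => by ring

theorem posDef_of_coercive {G : Matrix (Fin N) (Fin N) ℝ} (hs : G.IsSymm) {ε : ℝ} (hε : 0 < ε)
    (hG : ∀ v : Fin N → ℝ, ε * ∑ j, v j ^ 2 ≤ ∑ j, ∑ l, G j l * v j * v l) : G.PosDef := by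
  refine Matrix.PosDef.of_dotProduct_mulVec_pos ?_ fun x hx => ?_
  · rw [Matrix.IsHermitian, Matrix.conjTranspose_eq_transpose_of_trivial]; exact hs
  · have h := hG x
    rw [← dotProduct_mulVec_eq_sum] at h
    refine lt_of_lt_of_le (mul_pos hε ?_) h
    obtain ⟨i, hi⟩ := Function.ne_iff.1 hx
    exact Finset.sum_pos' (fun j _ => sq_nonneg _) ⟨i, Finset.mem_univ i, by
      have : x i ≠ 0 := hi
      positivity⟩

theorem abs_inv_apply_le {G : Matrix (Fin N) (Fin N) ℝ} (hs : G.IsSymm) {ε : ℝ} (hε : 0 < ε)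
    (hG : ∀ v : Fin N → ℝ, ε * ∑ j, v j ^ 2 ≤ ∑ j, ∑ l, G j l * v j * v l) (j l : Fin N) :
    |G⁻¹ j l| ≤ 1 / ε := by
  have hdet : IsUnit G.det := (posDef_of_coercive hs hε hG).det_pos.ne'.isUnit
  set w : Fin N → ℝ := fun i => G⁻¹ i l with hw
  have hGw : G *ᵥ w = Pi.single l 1 := by
    have : w = G⁻¹ *ᵥ Pi.single l 1 := by ext i; simp [hw]
    rw [this, mulVec_mulVec, mul_nonsing_inv _ hdet, one_mulVec]
  have h := hG w
  rw [← dotProduct_mulVec_eq_sum, hGw] at h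
  simp only [dotProduct_single, mul_one] at h
  have hle : ∀ i, w i ^ 2 ≤ ∑ j, w j ^ 2 := fun i =>
    Finset.single_le_sum (fun i _ => sq_nonneg (w i)) (Finset.mem_univ i)
  have h1 : ε * w l ^ 2 ≤ w l := (mul_le_mul_of_nonneg_left (hle l) hε.le).trans h
  have h2 : ε * w l ≤ 1 := by
    by_contra hc
    nlinarith
  have h3 : ε * w j ^ 2 ≤ w l := (mul_le_mul_of_nonneg_left (hle j) hε.le).trans h
  refine abs_le_of_sq_le_sq ?_ (by positivity)
  rw [div_pow, one_pow, le_div_iff₀ (by positivity)]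
  nlinarith

theorem coercive_inv {G : Matrix (Fin N) (Fin N) ℝ} (hs : G.IsSymm) {ε C : ℝ} (hε : 0 < ε)
    (hG : ∀ v : Fin N → ℝ, ε * ∑ j, v j ^ 2 ≤ ∑ j, ∑ l, G j l * v j * v l)
    (hC : ∀ j l, |G j l| ≤ C) (v : Fin N → ℝ) :
    ε * ∑ j, v j ^ 2 ≤ ((N * C) ^ 2 + 1) * (v ⬝ᵥ G⁻¹ *ᵥ v) := by
  have hdet : IsUnit G.det := (posDef_of_coercive hs hε hG).det_pos.ne'.isUnit
  set w := G⁻¹ *ᵥ v with hw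
  have hv : v = G *ᵥ w := by rw [hw, mulVec_mulVec, mul_nonsing_inv _ hdet, one_mulVec]
  have h := hG w
  rw [← dotProduct_mulVec_eq_sum, ← hv, dotProduct_comm] at h
  have h1 : ∀ j, v j ^ 2 ≤ N * C ^ 2 * ∑ l, w l ^ 2 := by
    intro j
    have hj : v j = ∑ l, G j l * w l := congrFun hv j
    rw [hj]
    refine (Finset.sum_mul_sq_le_sq_mul_sq _ _ _).trans ?_
    gcongr
    refine (Finset.sum_le_card_nsmul _ _ (C ^ 2) fun l _ => ?_).trans (by simp)
    exact sq_le_sq' (by linarith [(abs_le.1 (hC j l)).1]) (abs_le.1 (hC j l)).2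
  have h2 : ∑ j, v j ^ 2 ≤ (N * C) ^ 2 * ∑ l, w l ^ 2 := by
    refine (Finset.sum_le_card_nsmul _ _ _ fun j _ => h1 j).trans ?_
    simp only [Finset.card_univ, Fintype.card_fin, nsmul_eq_mul]
    exact le_of_eq (by ring)
  have h0 : 0 ≤ ∑ l, w l ^ 2 := Finset.sum_nonneg fun _ _ => sq_nonneg _
  calc ε * ∑ j, v j ^ 2 ≤ ε * ((N * C) ^ 2 * ∑ l, w l ^ 2) := by gcongr
    _ = (N * C) ^ 2 * (ε * ∑ l, w l ^ 2) := by ring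
    _ ≤ (N * C) ^ 2 * (v ⬝ᵥ w) := by gcongr
    _ ≤ _ := by
      have : 0 ≤ v ⬝ᵥ w := le_trans (by positivity) h
      nlinarith

theorem bddLip_inv_apply {g : (Fin N → ℝ) → Matrix (Fin N) (Fin N) ℝ} (hs : ∀ Z, (g Z).IsSymm)
    {ε : ℝ} (hε : 0 < ε)
    (hG : ∀ Z (v : Fin N → ℝ), ε * ∑ j, v j ^ 2 ≤ ∑ j, ∑ l, g Z j l * v j * v l)
    (hg : ∀ j l, BddLip fun Z => g Z j l) (j l : Fin N) : BddLip fun Z => (g Z)⁻¹ j l := by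
  obtain ⟨C, hC, -, hl⟩ := BddLip.exists_common (f := fun (i : Fin N × Fin N) Z => g Z i.1 i.2)
    fun i => hg i.1 i.2
  have hdet : ∀ Z, IsUnit (g Z).det := fun Z =>
    (posDef_of_coercive (hs Z) hε (hG Z)).det_pos.ne'.isUnit
  have hb := fun Z => abs_inv_apply_le (hs Z) hε (hG Z)
  refine ⟨1 / ε + N * (N * (1 / ε * C * (1 / ε))), by positivity,
    fun Z => (hb Z j l).trans (le_add_of_nonneg_right (by positivity)), fun Z Y => ?_⟩
  have e : (g Z)⁻¹ - (g Y)⁻¹ = (g Z)⁻¹ * (g Y - g Z) * (g Y)⁻¹ := by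
    rw [mul_sub, sub_mul, nonsing_inv_mul _ (hdet Z), one_mul, mul_assoc,
      mul_nonsing_inv _ (hdet Y), mul_one]
  have e' := congrFun (congrFun e j) l
  rw [Matrix.sub_apply] at e'
  rw [e', Matrix.mul_apply]
  have hd : 0 ≤ dist Z Y := dist_nonneg
  have hin : ∀ i, |((g Z)⁻¹ * (g Y - g Z)) j i| ≤ N * (1 / ε * (C * dist Z Y)) := by
    intro i
    rw [Matrix.mul_apply]
    refine (Finset.abs_sum_le_sum_abs _ _).trans
      ((Finset.sum_le_card_nsmul _ _ (1 / ε * (C * dist Z Y)) fun k _ => ?_).trans (by simp))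
    rw [abs_mul, Matrix.sub_apply]
    have := hl (k, i) Y Z
    rw [dist_comm] at this
    exact mul_le_mul (hb Z j k) this (abs_nonneg _) (by positivity)
  calc _ ≤ ∑ i : Fin N, |((g Z)⁻¹ * (g Y - g Z)) j i * (g Y)⁻¹ i l| :=
        Finset.abs_sum_le_sum_abs _ _
    _ ≤ N * (N * (1 / ε * (C * dist Z Y)) * (1 / ε)) := by
        refine (Finset.sum_le_card_nsmul _ _ (N * (1 / ε * (C * dist Z Y)) * (1 / ε))
          fun i _ => ?_).trans (by simp)
        rw [abs_mul]
        exact mul_le_mul (hin i) (hb Y i l) (abs_nonneg _) (by positivity)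
    _ = N * (N * (1 / ε * C * (1 / ε))) * dist Z Y := by ring
    _ ≤ _ := by gcongr; exact le_add_of_nonneg_left (by positivity)

theorem bddLip_det {g : (Fin N → ℝ) → Matrix (Fin N) (Fin N) ℝ}
    (hg : ∀ j l, BddLip fun Z => g Z j l) : BddLip fun Z => (g Z).det := by
  simp only [Matrix.det_apply']
  exact BddLip.sum _ fun σ => (BddLip.const _).mul (BddLip.prod _ fun i => hg _ _)

theorem exists_det_lower_bound {g : (Fin N → ℝ) → Matrix (Fin N) (Fin N) ℝ}
    (hs : ∀ Z, (g Z).IsSymm) {ε : ℝ} (hε : 0 < ε)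
    (hG : ∀ Z (v : Fin N → ℝ), ε * ∑ j, v j ^ 2 ≤ ∑ j, ∑ l, g Z j l * v j * v l)
    (hg : ∀ j l, BddLip fun Z => g Z j l) : ∃ δ > 0, ∀ Z, δ ≤ (g Z).det := by
  obtain ⟨C, hC, hb, -⟩ := bddLip_det (bddLip_inv_apply hs hε hG hg)
  refine ⟨1 / (C + 1), by positivity, fun Z => ?_⟩
  have hpos := (posDef_of_coercive (hs Z) hε (hG Z)).det_pos
  have h1 : (g Z)⁻¹.det * (g Z).det = 1 := by
    rw [← det_mul, nonsing_inv_mul _ hpos.ne'.isUnit, det_one]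
  have h2 : (g Z)⁻¹.det ≤ C := (le_abs_self _).trans (hb Z)
  rw [div_le_iff₀ (by positivity)]
  nlinarith

end UniformlyElliptic

theorem sum_sq_mul_le {N : ℕ} (E : Fin N → Fin N → ℝ) {c : ℝ} (hE : ∀ j l, |E j l| ≤ c)
    (x : Fin N → ℝ) : ∑ j, ∑ l, E j l * (x j * x l) ≤ N * c * ∑ j, x j ^ 2 := by
  calc ∑ j, ∑ l, E j l * (x j * x l) ≤ ∑ j, ∑ l, c * (x j ^ 2 / 2 + x l ^ 2 / 2) := by
        refine Finset.sum_le_sum fun j _ => Finset.sum_le_sum fun l _ => ?_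
        calc E j l * (x j * x l) ≤ |E j l| * |x j * x l| := by
              rw [← abs_mul]; exact le_abs_self _
          _ ≤ c * (x j ^ 2 / 2 + x l ^ 2 / 2) := by
              refine mul_le_mul (hE j l) ?_ (abs_nonneg _) ((abs_nonneg _).trans (hE j l))
              rw [abs_le]
              constructor <;> nlinarith [sq_nonneg (x j - x l), sq_nonneg (x j + x l)]
    _ = _ := by
        simp only [← Finset.mul_sum, Finset.sum_add_distrib, ← Finset.sum_div, Finset.sum_const,
          Finset.card_univ, Fintype.card_fin, nsmul_eq_mul]
        ring

/-- A bounded field of bivectors that calibrates `h` and pairs with `B` to at least `2m` can be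
smoothed at scale `r` with errors `O(r)` and derivative `O(r⁻¹)`. -/
theorem exists_smooth_calibration {n : ℕ}
    (κ h B : Fin (2 * n) → Fin (2 * n) → (Fin (2 * n) → ℝ) → ℝ) (m : (Fin (2 * n) → ℝ) → ℝ)
    (hh : ∀ j l, BddLip (h j l)) (hB : ∀ j l, BddLip (B j l)) (hm : BddLip m)
    {M : ℝ} (hM : 0 ≤ M) (hκM : ∀ j l Z, |κ j l Z| ≤ M) (hκ : ∀ j l Z, κ l j Z = -κ j l Z)
    (hκh : ∀ Z (x y : Fin (2 * n) → ℝ), 2 * ∑ j, ∑ l, κ j l Z * (x j * y l) ≤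
      ∑ j, ∑ l, h j l Z * (x j * x l + y j * y l))
    (hκB : ∀ Z, 2 * m Z ≤ ∑ j, ∑ l, κ j l Z * B j l Z) :
    ∃ D, 0 ≤ D ∧ ∀ r : ℝ, 0 < r → ∃ T : Fin (2 * n) → Fin (2 * n) → (Fin (2 * n) → ℝ) → ℝ,
      (∀ j l, ContDiff ℝ (⊤ : ℕ∞) (T j l)) ∧ (∀ j l Z, T l j Z = -T j l Z) ∧
      (∀ i j l Z, |pdR i (T j l) Z| ≤ D / r) ∧
      (∀ Z (x y : Fin (2 * n) → ℝ), 2 * ∑ j, ∑ l, T j l Z * (x j * y l) ≤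
        ∑ j, ∑ l, h j l Z * (x j * x l + y j * y l)
          + D * r * (∑ j, x j ^ 2 + ∑ j, y j ^ 2)) ∧
      ∀ Z, 2 * m Z - D * r ≤ ∑ j, ∑ l, T j l Z * B j l Z := by
  obtain ⟨D₀, hD₀, hsm⟩ := exists_smoothing (2 * n) (Fin (2 * n) → Fin (2 * n) → ℝ)
  obtain ⟨C₁, hC₁, -, hl₁⟩ := BddLip.exists_common
    (f := fun (i : Fin (2 * n) × Fin (2 * n)) => h i.1 i.2) fun i => hh i.1 i.2
  obtain ⟨C₂, hC₂, -, hl₂⟩ := BddLip.exists_common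
    (f := fun (i : Fin (2 * n) × Fin (2 * n)) => B i.1 i.2) fun i => hB i.1 i.2
  obtain ⟨C₃, hC₃, -, hl₃⟩ := hm
  set N : ℝ := ((2 * n : ℕ) : ℝ) with hN
  have hN0 : 0 ≤ N := Nat.cast_nonneg _
  refine ⟨D₀ * M + N * C₁ + (2 * C₃ + N * (N * (M * C₂))), by positivity, fun r hr => ?_⟩
  have hκn : ∀ Z, ‖fun j l => κ j l Z‖ ≤ M := fun Z =>
    (pi_norm_le_iff_of_nonneg hM).2 fun j => (pi_norm_le_iff_of_nonneg hM).2 fun l => hκM j l Z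
  obtain ⟨T, hT, hT', hTs⟩ := hsm (fun Z j l => κ j l Z) M r hr hκn
  have half : ∀ (φ : (Fin (2 * n) → Fin (2 * n) → ℝ) → ℝ) (c : ℝ) (Z : Fin (2 * n) → ℝ),
      IsLinearMap ℝ φ → Continuous φ →
      (∀ Y, dist Y Z ≤ r → φ (fun j l => κ j l Y) ≤ c) → φ (T Z) ≤ c := by
    intro φ c Z hφ hφc hY
    exact hTs Z {t | φ t ≤ c} (convex_halfSpace_le hφ c) (isClosed_le hφc continuous_const) hY
  have hlin : ∀ w : Fin (2 * n) → Fin (2 * n) → ℝ,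
      IsLinearMap ℝ fun t : Fin (2 * n) → Fin (2 * n) → ℝ => ∑ j, ∑ l, t j l * w j l := by
    intro w
    constructor
    · intro s t
      simp only [Pi.add_apply, add_mul, Finset.sum_add_distrib]
    · intro c t
      simp only [Pi.smul_apply, smul_eq_mul, mul_assoc, Finset.mul_sum]
  have hTc : ∀ j l, ContDiff ℝ (⊤ : ℕ∞) fun Z => T Z j l := fun j l =>
    contDiff_pi.1 (contDiff_pi.1 hT j) l
  refine ⟨fun j l Z => T Z j l, hTc, fun j l Z => ?_, fun i j l Z => ?_, fun Z x y => ?_,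
    fun Z => ?_⟩
  · have h1 := half (fun t => t l j + t j l) 0 Z
      ⟨fun s t => by simp only [Pi.add_apply]; ring,
        fun c t => by simp only [Pi.smul_apply, smul_eq_mul]; ring⟩ (by fun_prop)
      (fun Y _ => by simp [hκ j l Y])
    have h2 := half (fun t => -(t l j + t j l)) 0 Z
      ⟨fun s t => by simp only [Pi.add_apply]; ring,
        fun c t => by simp only [Pi.smul_apply, smul_eq_mul]; ring⟩ (by fun_prop)
      (fun Y _ => by simp [hκ j l Y])
    show T Z l j = -T Z j l
    linarith
  · have hd := hT.differentiable (by simp) Z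
    have e : pdR i (fun Z => T Z j l) Z = fderiv ℝ T Z (Pi.single i 1) j l := by
      have h1 := hasFDerivAt_pi'.1 (hasFDerivAt_pi'.1 hd.hasFDerivAt j) l
      rw [pdR, h1.fderiv]
      rfl
    rw [e]
    calc |fderiv ℝ T Z (Pi.single i 1) j l| ≤ ‖fderiv ℝ T Z (Pi.single i 1)‖ :=
          (norm_le_pi_norm (fderiv ℝ T Z (Pi.single i 1) j) l).trans (norm_le_pi_norm _ j)
      _ ≤ ‖fderiv ℝ T Z‖ * ‖(Pi.single i 1 : Fin (2 * n) → ℝ)‖ := ContinuousLinearMap.le_opNorm _ _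
      _ ≤ D₀ * M / r * 1 := by
          gcongr
          · exact hT' Z
          · rw [Pi.norm_single]; simp
      _ ≤ _ := by
          rw [mul_one]
          gcongr
          have : 0 ≤ N * C₁ + (2 * C₃ + N * (N * (M * C₂))) := by positivity
          linarith
  · have key := half (fun t => ∑ j, ∑ l, t j l * (2 * (x j * y l)))
      (∑ j, ∑ l, h j l Z * (x j * x l + y j * y l)
        + N * C₁ * r * (∑ j, x j ^ 2 + ∑ j, y j ^ 2)) Z (hlin _) (by fun_prop) (fun Y hY => by
        have h1 := hκh Y x y
        have hE : ∀ j l, |h j l Y - h j l Z| ≤ C₁ * r := fun j l =>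
          (hl₁ (j, l) Y Z).trans (by gcongr)
        have h2 := sum_sq_mul_le (fun j l => h j l Y - h j l Z) hE x
        have h3 := sum_sq_mul_le (fun j l => h j l Y - h j l Z) hE y
        have e1 : ∑ j, ∑ l, κ j l Y * (2 * (x j * y l)) =
            2 * ∑ j, ∑ l, κ j l Y * (x j * y l) := by
          simp only [Finset.mul_sum]
          exact Finset.sum_congr rfl fun j _ => Finset.sum_congr rfl fun l _ => by ring
        simp only [sub_mul, mul_add, Finset.sum_sub_distrib, Finset.sum_add_distrib] at h1 h2 h3 ⊢
        rw [e1]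
        linarith)
    have e1 : ∑ j, ∑ l, T Z j l * (2 * (x j * y l)) =
        2 * ∑ j, ∑ l, T Z j l * (x j * y l) := by
      simp only [Finset.mul_sum]
      exact Finset.sum_congr rfl fun j _ => Finset.sum_congr rfl fun l _ => by ring
    simp only [e1] at key
    refine key.trans ?_
    have hs : 0 ≤ ∑ j, x j ^ 2 + ∑ j, y j ^ 2 := by positivity
    gcongr
    have : 0 ≤ D₀ * M + (2 * C₃ + N * (N * (M * C₂))) := by positivity
    linarith
  · have key := half (fun t => ∑ j, ∑ l, t j l * -B j l Z)
      (-(2 * m Z) + (2 * C₃ + N * (N * (M * C₂))) * r) Z (hlin _) (by fun_prop) (fun Y hY => by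
        have h1 := hκB Y
        have h2 : |m Y - m Z| ≤ C₃ * r := (hl₃ Y Z).trans (by gcongr)
        have h3 : ∑ j, ∑ l, κ j l Y * (B j l Y - B j l Z) ≤ N * (N * (M * (C₂ * r))) := by
          refine (Finset.sum_le_card_nsmul _ _ (N * (M * (C₂ * r))) fun j _ =>
            (Finset.sum_le_card_nsmul _ _ (M * (C₂ * r)) fun l _ => ?_).trans (by simp [hN])).trans
            (by simp [hN])
          refine (le_abs_self _).trans ?_
          rw [abs_mul]
          exact mul_le_mul (hκM j l Y) ((hl₂ (j, l) Y Z).trans (by gcongr)) (abs_nonneg _) hM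
        simp only [mul_sub, mul_neg, Finset.sum_sub_distrib, Finset.sum_neg_distrib] at h3 ⊢
        linarith [(abs_le.1 h2).1])
    simp only [mul_neg, Finset.sum_neg_distrib] at key
    have : 0 ≤ (D₀ * M + N * C₁) * r := by positivity
    linarith

section QuadraticForm

variable {n : ℕ} {A : Fin (2 * n) → (Fin (2 * n) → ℝ) → ℝ} {u : (Fin (2 * n) → ℝ) → ℂ}

theorem sum_norm_sq_mg (p : ℕ) (Z : Fin (2 * n) → ℝ) :
    ∑ j, ‖mg A p j u Z‖ ^ 2 = ∑ j, (mg A p j u Z).re ^ 2 + ∑ j, (mg A p j u Z).im ^ 2 := by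
  rw [← Finset.sum_add_distrib]
  refine Finset.sum_congr rfl fun j _ => ?_
  rw [Complex.sq_norm, Complex.normSq_apply]
  ring

theorem abs_sum_pdR_mul_current_le {r D : ℝ} (hr : 0 < r) {p : ℕ} (hrp : p * r ^ 4 = 1)
    {T : Fin (2 * n) → Fin (2 * n) → (Fin (2 * n) → ℝ) → ℝ}
    (hdT : ∀ i j l Z, |pdR i (T j l) Z| ≤ D / r) (Z : Fin (2 * n) → ℝ) :
    |∑ j, ∑ l, pdR j (T j l) Z * current A p l u Z| ≤
      ((2 * n : ℕ) : ℝ) * (r * ∑ l, ‖mg A p l u Z‖ ^ 2)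
        + p * (((2 * n : ℕ) : ℝ) ^ 2 * D ^ 2 * r * ‖u Z‖ ^ 2) := by
  have h : ∀ j l, |pdR j (T j l) Z * current A p l u Z| ≤
      r * ‖mg A p l u Z‖ ^ 2 + p * (D ^ 2 * r * ‖u Z‖ ^ 2) := by
    intro j l
    rw [abs_mul]
    refine (mul_le_mul (hdT j j l Z) (abs_current_le p l Z) (abs_nonneg _)
      ((abs_nonneg _).trans (hdT j j l Z))).trans ?_
    have e : p * (D ^ 2 * r * ‖u Z‖ ^ 2) = r * (D / r ^ 2 * ‖u Z‖) ^ 2 := by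
      have : (p : ℝ) = 1 / r ^ 4 := by rw [eq_div_iff (by positivity), hrp]
      rw [this]; field_simp
    have e' : D / r * (‖u Z‖ * ‖mg A p l u Z‖) = r * (D / r ^ 2 * ‖u Z‖ * ‖mg A p l u Z‖) := by
      field_simp
    rw [e, e']
    nlinarith [mul_nonneg hr.le (sq_nonneg (D / r ^ 2 * ‖u Z‖ - ‖mg A p l u Z‖)),
      mul_nonneg hr.le (sq_nonneg (D / r ^ 2 * ‖u Z‖)),
      mul_nonneg hr.le (sq_nonneg ‖mg A p l u Z‖)]
  calc |∑ j, ∑ l, pdR j (T j l) Z * current A p l u Z|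
      ≤ ∑ _j : Fin (2 * n), ∑ l : Fin (2 * n),
          (r * ‖mg A p l u Z‖ ^ 2 + p * (D ^ 2 * r * ‖u Z‖ ^ 2)) :=
        (Finset.abs_sum_le_sum_abs _ _).trans <| Finset.sum_le_sum fun j _ =>
          (Finset.abs_sum_le_sum_abs _ _).trans <| Finset.sum_le_sum fun l _ => h j l
    _ = _ := by
        rw [Finset.sum_const, Finset.sum_add_distrib, Finset.sum_const, ← Finset.mul_sum]
        simp only [Finset.card_univ, Fintype.card_fin, nsmul_eq_mul]
        ring

theorem potential_le_energy_density (hA : ∀ j, ContDiff ℝ (⊤ : ℕ∞) (A j))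
    (hu : ContDiff ℝ (⊤ : ℕ∞) u) {r D : ℝ} (hr : 0 < r) {p : ℕ} (hrp : p * r ^ 4 = 1)
    {h T : Fin (2 * n) → Fin (2 * n) → (Fin (2 * n) → ℝ) → ℝ} {m : (Fin (2 * n) → ℝ) → ℝ}
    (hT : ∀ j l Z, T l j Z = -T j l Z)
    (hdT : ∀ i j l Z, |pdR i (T j l) Z| ≤ D / r)
    (hTh : ∀ Z (x y : Fin (2 * n) → ℝ), 2 * ∑ j, ∑ l, T j l Z * (x j * y l) ≤
      ∑ j, ∑ l, h j l Z * (x j * x l + y j * y l)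
        + D * r * (∑ j, x j ^ 2 + ∑ j, y j ^ 2))
    (hTB : ∀ Z, 2 * m Z - D * r ≤ ∑ j, ∑ l, T j l Z * Bfield A Z j l) (Z : Fin (2 * n) → ℝ) :
    p * (m Z * ‖u Z‖ ^ 2 - (D / 2 + ((2 * n : ℕ) : ℝ) ^ 2 * D ^ 2) * r * ‖u Z‖ ^ 2) ≤
      ∑ j, ∑ l, h j l Z * ((mg A p j u Z).re * (mg A p l u Z).re
          + (mg A p j u Z).im * (mg A p l u Z).im)
        + (D + ((2 * n : ℕ) : ℝ)) * r * ∑ j, ‖mg A p j u Z‖ ^ 2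
        + ∑ j, ∑ l, (T j l Z * pdR j (current A p l u) Z
          + pdR j (T j l) Z * current A p l u Z) := by
  have h1 := sum_antisymm_mul_mg hA hu p (fun j l => T j l Z) (fun j l => hT j l Z) Z
  have h2 := hTh Z (fun j => (mg A p j u Z).re) (fun j => (mg A p j u Z).im)
  rw [← sum_norm_sq_mg] at h2
  have h3 := (abs_le.1 (abs_sum_pdR_mul_current_le (A := A) (u := u) hr hrp hdT Z)).1
  have h4 : p / 2 * (2 * m Z - D * r) * ‖u Z‖ ^ 2 ≤
      p / 2 * (∑ j, ∑ l, T j l Z * Bfield A Z j l) * ‖u Z‖ ^ 2 := by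
    gcongr
    exact hTB Z
  have e : ∑ j, ∑ l, T j l Z * (2 * (mg A p j u Z).re * (mg A p l u Z).im
      + pdR j (current A p l u) Z) =
      2 * ∑ j, ∑ l, T j l Z * ((mg A p j u Z).re * (mg A p l u Z).im)
        + ∑ j, ∑ l, T j l Z * pdR j (current A p l u) Z := by
    rw [Finset.mul_sum, ← Finset.sum_add_distrib]
    refine Finset.sum_congr rfl fun j _ => ?_
    rw [Finset.mul_sum, ← Finset.sum_add_distrib]
    exact Finset.sum_congr rfl fun l _ => by ring
  rw [e] at h1
  simp only [mul_add, Finset.sum_add_distrib] at h2 h3 ⊢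
  linarith

theorem continuous_mg (hA : ∀ j, ContDiff ℝ (⊤ : ℕ∞) (A j)) (hu : ContDiff ℝ (⊤ : ℕ∞) u)
    (p : ℕ) (j : Fin (2 * n)) : Continuous (mg A p j u) := by
  have h1 : Continuous (pd j u) :=
    (hu.continuous_fderiv (by simp)).clm_apply continuous_const
  exact (continuous_const.mul h1).add ((continuous_const.mul
    (Complex.continuous_ofReal.comp (hA j).continuous)).mul hu.continuous)

theorem mg_eq_zero_of_notMem_tsupport {Z : Fin (2 * n) → ℝ} (hZ : Z ∉ tsupport u) (p : ℕ)
    (j : Fin (2 * n)) : mg A p j u Z = 0 := by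
  have h1 : fderiv ℝ u Z = 0 := by
    by_contra h
    exact hZ (support_fderiv_subset ℝ h)
  simp [mg, pd, h1, image_eq_zero_of_notMem_tsupport hZ]

theorem integral_potential_le_energy (hA : ∀ j, ContDiff ℝ (⊤ : ℕ∞) (A j))
    (hu : ContDiff ℝ (⊤ : ℕ∞) u) (hc : HasCompactSupport u) {r D : ℝ} (hr : 0 < r) {p : ℕ}
    (hp : 0 < p) (hrp : p * r ^ 4 = 1) (hD : 0 ≤ D)
    {h T : Fin (2 * n) → Fin (2 * n) → (Fin (2 * n) → ℝ) → ℝ} {m W : (Fin (2 * n) → ℝ) → ℝ}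
    (hh : ∀ j l, Continuous (h j l)) (hm : Continuous m) (hW : Continuous W)
    {C₁ C₂ : ℝ} (hC₂ : ∀ Z, 1 ≤ C₂ * W Z)
    (hC₁ : ∀ Z (v : Fin (2 * n) → ℝ), ∑ j, v j ^ 2 ≤ C₁ * ∑ j, ∑ l, h j l Z * (v j * v l))
    (hTs : ∀ j l, ContDiff ℝ (⊤ : ℕ∞) (T j l)) (hT : ∀ j l Z, T l j Z = -T j l Z)
    (hdT : ∀ i j l Z, |pdR i (T j l) Z| ≤ D / r)
    (hTh : ∀ Z (x y : Fin (2 * n) → ℝ), 2 * ∑ j, ∑ l, T j l Z * (x j * y l) ≤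
      ∑ j, ∑ l, h j l Z * (x j * x l + y j * y l)
        + D * r * (∑ j, x j ^ 2 + ∑ j, y j ^ 2))
    (hTB : ∀ Z, 2 * m Z - D * r ≤ ∑ j, ∑ l, T j l Z * Bfield A Z j l) :
    (∫ Z, m Z * ‖u Z‖ ^ 2) - (D / 2 + ((2 * n : ℕ) : ℝ) ^ 2 * D ^ 2) * C₂ * r *
        ∫ Z, ‖u Z‖ ^ 2 * W Z ≤
      (1 + (D + ((2 * n : ℕ) : ℝ)) * C₁ * r) * (1 / p *
        ∫ Z, ∑ j, ∑ l, h j l Z * ((mg A p j u Z).re * (mg A p l u Z).re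
          + (mg A p j u Z).im * (mg A p l u Z).im)) := by
  set D' := D / 2 + ((2 * n : ℕ) : ℝ) ^ 2 * D ^ 2 with hD'
  have hD'0 : 0 ≤ D' := by positivity
  set q : (Fin (2 * n) → ℝ) → ℝ := fun Z => ∑ j, ∑ l, h j l Z *
    ((mg A p j u Z).re * (mg A p l u Z).re + (mg A p j u Z).im * (mg A p l u Z).im) with hq
  obtain ⟨hδ, hδ0⟩ := integral_sum_mul_pdR_current hA hu hc p T hTs
  have hmg := fun j => continuous_mg hA hu p j
  have hsupp : ∀ {f : (Fin (2 * n) → ℝ) → ℝ}, Continuous f → (∀ Z, Z ∉ tsupport u → f Z = 0) →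
      Integrable f := fun hf hf0 =>
    hf.integrable_of_hasCompactSupport (HasCompactSupport.intro hc hf0)
  have hqi : Integrable q := by
    refine hsupp ?_ fun Z hZ => ?_
    · refine continuous_finsetSum _ fun j _ => continuous_finsetSum _ fun l _ => (hh j l).mul ?_
      exact ((Complex.continuous_re.comp (hmg j)).mul (Complex.continuous_re.comp (hmg l))).add
        ((Complex.continuous_im.comp (hmg j)).mul (Complex.continuous_im.comp (hmg l)))
    · simp [hq, mg_eq_zero_of_notMem_tsupport hZ]
  have hmi : Integrable fun Z => m Z * ‖u Z‖ ^ 2 :=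
    hsupp (hm.mul (hu.continuous.norm.pow 2)) fun Z hZ => by
      simp [image_eq_zero_of_notMem_tsupport hZ]
  have hWi : Integrable fun Z => ‖u Z‖ ^ 2 * W Z :=
    hsupp ((hu.continuous.norm.pow 2).mul hW) fun Z hZ => by
      simp [image_eq_zero_of_notMem_tsupport hZ]
  have key : ∀ Z, p * (m Z * ‖u Z‖ ^ 2 - D' * C₂ * r * (‖u Z‖ ^ 2 * W Z)) ≤
      (1 + (D + ((2 * n : ℕ) : ℝ)) * C₁ * r) * q Z + ∑ j, ∑ l, (T j l Z *
        pdR j (current A p l u) Z + pdR j (T j l) Z * current A p l u Z) := by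
    intro Z
    have h1 := potential_le_energy_density hA hu hr hrp hT hdT hTh hTB Z
    have h2 : ∑ j, ‖mg A p j u Z‖ ^ 2 ≤ C₁ * q Z := by
      rw [sum_norm_sq_mg]
      have e : q Z = ∑ j, ∑ l, h j l Z * ((mg A p j u Z).re * (mg A p l u Z).re)
          + ∑ j, ∑ l, h j l Z * ((mg A p j u Z).im * (mg A p l u Z).im) := by
        simp only [hq, mul_add, Finset.sum_add_distrib]
      rw [e, mul_add]
      exact add_le_add (hC₁ Z _) (hC₁ Z _)
    have h3 : (D + ((2 * n : ℕ) : ℝ)) * r * ∑ j, ‖mg A p j u Z‖ ^ 2 ≤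
        (D + ((2 * n : ℕ) : ℝ)) * r * (C₁ * q Z) := by gcongr
    have h4 : p * (D' * r * ‖u Z‖ ^ 2) ≤ p * (D' * r * ‖u Z‖ ^ 2 * (C₂ * W Z)) :=
      mul_le_mul_of_nonneg_left (le_mul_of_one_le_right (by positivity) (hC₂ Z)) (by positivity)
    rw [← hD'] at h1
    change _ ≤ q Z + _ + _ at h1
    linarith
  have hfi := integral_mono (((hmi.sub (hWi.const_mul (D' * C₂ * r))).const_mul (p : ℝ)))
    ((hqi.const_mul (1 + (D + ((2 * n : ℕ) : ℝ)) * C₁ * r)).add hδ) key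
  simp only [Pi.sub_apply, Pi.add_apply] at hfi
  rw [integral_const_mul, integral_sub hmi (hWi.const_mul _), integral_const_mul,
    integral_add (hqi.const_mul _) hδ, hδ0, integral_const_mul, add_zero] at hfi
  have hp' : (0 : ℝ) < p := by exact_mod_cast hp
  calc _ = 1 / (p : ℝ) * (p * ((∫ Z, m Z * ‖u Z‖ ^ 2) - D' * C₂ * r * ∫ Z, ‖u Z‖ ^ 2 * W Z)) := by
        field_simp
    _ ≤ 1 / (p : ℝ) * ((1 + (D + ((2 * n : ℕ) : ℝ)) * C₁ * r) * ∫ Z, q Z) := by gcongr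
    _ = _ := by ring

end QuadraticForm

theorem bfield_transpose {n : ℕ} (A : Fin (2 * n) → (Fin (2 * n) → ℝ) → ℝ)
    (Z : Fin (2 * n) → ℝ) : (Bfield A Z)ᵀ = -Bfield A Z := by
  ext j k
  simp [Bfield]

theorem abs_apply_le_of_contraction {N : ℕ} {K H : Matrix (Fin N) (Fin N) ℝ} {M : ℝ}
    (hK : ∀ x y, 2 * (x ⬝ᵥ K *ᵥ y) ≤ x ⬝ᵥ H *ᵥ x + y ⬝ᵥ H *ᵥ y) (hH : ∀ j l, |H j l| ≤ M)
    (j l : Fin N) : |K j l| ≤ M := by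
  have h1 := hK (Pi.single j 1) (Pi.single l 1)
  have h2 := hK (-Pi.single j 1) (Pi.single l 1)
  simp only [mulVec_single_one, single_one_dotProduct, mulVec_neg, neg_dotProduct,
    dotProduct_neg, neg_neg, col_apply] at h1 h2
  have h3 := (abs_le.1 (hH j j)).2
  have h4 := (abs_le.1 (hH l l)).2
  rw [abs_le]
  constructor <;> linarith

/-- Absorbing the relative error `1 + C r` of the energy into an error term of order `r`. -/
theorem sub_le_of_sub_le_one_add_mul {x q N r C E b : ℝ} (h : x - E * r * N ≤ (1 + C * r) * q)
    (hx : x ≤ b * N) (hN : 0 ≤ N) (hr : 0 < r) (hC : 0 ≤ C) (hE : 0 ≤ E) (hb : 0 ≤ b) :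
    x - (C * b + E + 1) * r * N ≤ q := by
  have h1 : (1 + C * r) * (x - (C * b + E + 1) * r * N) ≤ (1 + C * r) * q := by
    refine le_trans ?_ h
    have h2 : C * r * x ≤ C * r * (b * N) := by gcongr
    have h3 : 0 ≤ C * r * ((C * b + E + 1) * r * N) := by positivity
    have h4 : 0 ≤ r * N := by positivity
    linarith
  exact le_of_mul_le_mul_left h1 (by positivity)

theorem re_inner_mg {n : ℕ} {A : Fin (2 * n) → (Fin (2 * n) → ℝ) → ℝ}
    {u : (Fin (2 * n) → ℝ) → ℂ} (p : ℕ) (H : Matrix (Fin (2 * n)) (Fin (2 * n)) ℝ) (w : ℝ)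
    (Z : Fin (2 * n) → ℝ) :
    ((∑ j, ∑ l, ((H j l : ℝ) : ℂ) * mg A p j u Z * (starRingEnd ℂ) (mg A p l u Z)) * (w : ℂ)).re =
      ∑ j, ∑ l, w * H j l * ((mg A p j u Z).re * (mg A p l u Z).re
        + (mg A p j u Z).im * (mg A p l u Z).im) := by
  rw [Complex.re_mul_ofReal, Complex.re_sum, Finset.sum_mul]
  refine Finset.sum_congr rfl fun j _ => ?_
  rw [Complex.re_sum, Finset.sum_mul]
  refine Finset.sum_congr rfl fun l _ => ?_
  simp only [Complex.mul_re, Complex.mul_im, Complex.ofReal_re, Complex.ofReal_im,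
    Complex.conj_re, Complex.conj_im]
  ring

/-- Semiclassical lower bound for the bottom of the spectrum of the
Bochner–Schrödinger operator via its quadratic form:
`Q_p(u) ≥ (Λ₀ − c p^{-1/4})‖u‖²`, where
`Λ₀ = inf_Z (Σ_j a_j(Z) + V(Z))`. -/
theorem stmt1 (n : ℕ) (hn : 1 ≤ n)
    (g : (Fin (2*n) → ℝ) → Matrix (Fin (2*n)) (Fin (2*n)) ℝ)
    (hg_smooth : ∀ j l, ContDiff ℝ (⊤ : ℕ∞) fun Z => g Z j l)
    (hg_bdd : ∀ j l (k : ℕ), ∃ C, ∀ Z, ‖iteratedFDeriv ℝ k (fun Z => g Z j l) Z‖ ≤ C)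
    (hg_symm : ∀ Z, (g Z).IsSymm)
    (hg_pos : ∃ ε > 0, ∀ Z (v : Fin (2*n) → ℝ),
      ε * ∑ j, v j ^ 2 ≤ ∑ j, ∑ l, g Z j l * v j * v l)
    (A : Fin (2*n) → (Fin (2*n) → ℝ) → ℝ)
    (hA : ∀ j, ContDiff ℝ (⊤ : ℕ∞) (A j))
    (hB_bdd : ∀ j l (k : ℕ), ∃ C, ∀ Z,
      ‖iteratedFDeriv ℝ k (fun Z => Bfield A Z j l) Z‖ ≤ C)
    (b₀ : ℝ) (hb₀ : 0 < b₀)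
    (a : Fin n → (Fin (2*n) → ℝ) → ℝ)
    (ha_cont : ∀ j, Continuous (a j))
    (ha_lb : ∀ j Z, b₀ ≤ a j Z)
    (hchar : ∀ Z, ((g Z)⁻¹ * Bfield A Z).charpoly =
      ∏ j : Fin n, (Polynomial.X ^ 2 + Polynomial.C ((a j Z) ^ 2)))
    (V : (Fin (2*n) → ℝ) → ℝ)
    (hV : ContDiff ℝ (⊤ : ℕ∞) V)
    (hV_bdd : ∀ k : ℕ, ∃ C, ∀ Z, ‖iteratedFDeriv ℝ k V Z‖ ≤ C) :
    ∃ c > 0, ∀ p : ℕ, 0 < p →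
      ∀ u : (Fin (2*n) → ℝ) → ℂ,
        ContDiff ℝ (⊤ : ℕ∞) u → HasCompactSupport u →
        ((⨅ Z : Fin (2*n) → ℝ, (∑ j, a j Z + V Z)) - c * (p : ℝ) ^ (-(1/4 : ℝ))) *
            ∫ Z, ‖u Z‖ ^ 2 * Real.sqrt (g Z).det ≤
          ((1 / (p : ℂ)) * ∫ Z, (∑ j, ∑ l, (((g Z)⁻¹ j l : ℝ) : ℂ) *
              mg A p j u Z * (starRingEnd ℂ) (mg A p l u Z)) *
              ((Real.sqrt (g Z).det : ℝ) : ℂ)).re +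
            ∫ Z, V Z * ‖u Z‖ ^ 2 * Real.sqrt (g Z).det := by
  obtain ⟨ε, hε, hG⟩ := hg_pos
  have hg : ∀ j l, BddLip fun Z => g Z j l := fun j l =>
    .of_iteratedFDeriv (hg_smooth j l) (hg_bdd j l)
  have hB : ∀ j l, BddLip fun Z => Bfield A Z j l := fun j l =>
    .of_iteratedFDeriv ((contDiff_pdR (hA l) j).sub (contDiff_pdR (hA j) l)) (hB_bdd j l)
  have hVl : BddLip V := .of_iteratedFDeriv hV hV_bdd
  obtain ⟨δ, hδ, hdet⟩ := exists_det_lower_bound hg_symm hε hG hg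
  set W : (Fin (2 * n) → ℝ) → ℝ := fun Z => Real.sqrt (g Z).det with hW
  have hWl : BddLip W := (bddLip_det hg).sqrt hδ hdet
  have hWc : Continuous W := hWl.continuous
  have hsδ : 0 < √δ := Real.sqrt_pos.2 hδ
  have hWδ : ∀ Z, √δ ≤ W Z := fun Z => Real.sqrt_le_sqrt (hdet Z)
  have hW0 : ∀ Z, 0 < W Z := fun Z => hsδ.trans_le (hWδ Z)
  set Λ := ⨅ Z : Fin (2*n) → ℝ, (∑ j, a j Z + V Z) with hΛ
  have ha0 : ∀ j Z, 0 ≤ a j Z := fun j Z => hb₀.le.trans (ha_lb j Z)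
  have hΛle : ∀ Z, Λ ≤ ∑ j, a j Z + V Z := by
    obtain ⟨C, -, hC, -⟩ := hVl
    refine fun Z => ciInf_le ⟨-C, ?_⟩ Z
    rintro _ ⟨Y, rfl⟩
    have h1 := (abs_le.1 (hC Y)).1
    have h2 : 0 ≤ ∑ j, a j Y := Finset.sum_nonneg fun j _ => ha0 j Y
    change -C ≤ ∑ j, a j Y + V Y
    linarith
  choose K hKs hKc hKt using fun Z => exists_calibrating_bivector (g Z) (Bfield A Z)
    (fun j => a j Z) (fun j => ha0 j Z) (posDef_of_coercive (hg_symm Z) hε (hG Z))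
    (bfield_transpose A Z) (hchar Z)
  set h : Fin (2 * n) → Fin (2 * n) → (Fin (2 * n) → ℝ) → ℝ :=
    fun j l Z => W Z * (g Z)⁻¹ j l with hh_def
  have hh : ∀ j l, BddLip (h j l) := fun j l => hWl.mul (bddLip_inv_apply hg_symm hε hG hg j l)
  set m : (Fin (2 * n) → ℝ) → ℝ := fun Z => W Z * (Λ - V Z) with hm_def
  have hΛV : BddLip fun Z => Λ - V Z := (BddLip.const Λ).sub hVl
  have hm : BddLip m := hWl.mul hΛV
  obtain ⟨CW, hCW, hWb, -⟩ := hWl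
  obtain ⟨b, hb, hΛb, -⟩ := hΛV
  obtain ⟨Cg, hCg, hgb, -⟩ := BddLip.exists_common
    (f := fun (i : Fin (2 * n) × Fin (2 * n)) Z => g Z i.1 i.2) fun i => hg i.1 i.2
  have hquad : ∀ Z x y, W Z * (x ⬝ᵥ (g Z)⁻¹ *ᵥ y) = ∑ j, ∑ l, h j l Z * (x j * y l) := by
    intro Z x y
    simp only [dotProduct_mulVec_eq_sum, Finset.mul_sum, hh_def, mul_assoc]
  obtain ⟨D, hD, hcal⟩ := exists_smooth_calibration (fun j l Z => W Z * K Z j l) h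
    (fun j l Z => Bfield A Z j l) m hh hB hm (M := CW * (1 / ε)) (by positivity)
    (fun j l Z => by
      rw [abs_mul]
      exact mul_le_mul (hWb Z) (abs_apply_le_of_contraction (hKc Z)
        (abs_inv_apply_le (hg_symm Z) hε (hG Z)) j l) (abs_nonneg _) hCW)
    (fun j l Z => by
      have := congrFun (congrFun (hKs Z) j) l
      rw [transpose_apply] at this
      rw [this]
      exact mul_neg _ _)
    (fun Z x y => by
      have h1 := mul_le_mul_of_nonneg_left (hKc Z x y) (hW0 Z).le
      rw [mul_add, hquad, hquad, dotProduct_mulVec_eq_sum] at h1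
      simp only [mul_add, Finset.sum_add_distrib]
      refine le_of_eq_of_le ?_ h1
      rw [mul_left_comm]
      simp only [Finset.mul_sum, mul_assoc])
    (fun Z => by
      have h1 : ∑ j, ∑ l, W Z * K Z j l * Bfield A Z j l = W Z * (2 * ∑ j, a j Z) := by
        rw [← hKt Z, Finset.sum_comm]
        simp only [Matrix.trace, diag_apply, mul_apply, transpose_apply, Finset.mul_sum, mul_assoc]
      rw [h1, hm_def]
      nlinarith [mul_le_mul_of_nonneg_left (hΛle Z) (hW0 Z).le])
  set C₁ := (((2 * n : ℕ) * Cg) ^ 2 + 1) / (ε * √δ) with hC₁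
  have hC₁0 : 0 ≤ C₁ := by positivity
  have hcoer : ∀ Z (v : Fin (2 * n) → ℝ),
      ∑ j, v j ^ 2 ≤ C₁ * ∑ j, ∑ l, h j l Z * (v j * v l) := by
    intro Z v
    have h1 := coercive_inv (hg_symm Z) hε (hG Z) (fun j l => hgb (j, l) Z) v
    have h2 : 0 ≤ ∑ j, v j ^ 2 := Finset.sum_nonneg fun j _ => sq_nonneg _
    rw [← hquad, hC₁, div_mul_eq_mul_div, le_div_iff₀ (by positivity)]
    calc (∑ j, v j ^ 2) * (ε * √δ) ≤ (∑ j, v j ^ 2) * (ε * W Z) := by gcongr; exact hWδ Z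
      _ = W Z * (ε * ∑ j, v j ^ 2) := by ring
      _ ≤ W Z * ((((2 * n : ℕ) * Cg) ^ 2 + 1) * (v ⬝ᵥ (g Z)⁻¹ *ᵥ v)) :=
        mul_le_mul_of_nonneg_left h1 (hW0 Z).le
      _ = _ := by ring
  have hC₂ : ∀ Z, 1 ≤ 1 / √δ * W Z := fun Z => by
    rw [div_mul_eq_mul_div, one_mul, le_div_iff₀ hsδ, one_mul]
    exact hWδ Z
  refine ⟨(D + (2 * n : ℕ)) * C₁ * b + (D / 2 + ((2 * n : ℕ) : ℝ) ^ 2 * D ^ 2) * (1 / √δ) + 1,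
    by positivity, fun p hp u hu hc => ?_⟩
  have hp' : (0 : ℝ) < p := by exact_mod_cast hp
  set r : ℝ := (p : ℝ) ^ (-(1/4 : ℝ)) with hr_def
  have hr : 0 < r := Real.rpow_pos_of_pos hp' _
  have hrp : (p : ℝ) * r ^ 4 = 1 := by
    rw [hr_def, ← Real.rpow_natCast, ← Real.rpow_mul hp'.le]
    norm_num
    rw [Real.rpow_neg_one, mul_inv_cancel₀ hp'.ne']
  obtain ⟨T, hTs, hT, hdT, hTh, hTB⟩ := hcal r hr
  have main := integral_potential_le_energy hA hu hc hr hp hrp hD (fun j l => (hh j l).continuous)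
    hm.continuous hWc hC₂ hcoer hTs hT hdT hTh hTB
  have hfi : ∀ {f : (Fin (2 * n) → ℝ) → ℝ}, Continuous f → Integrable fun Z => f Z * ‖u Z‖ ^ 2 :=
    fun hf => (hf.mul (hu.continuous.norm.pow 2)).integrable_of_hasCompactSupport
      (hc.mono fun Z hZ h => hZ (by simp [h]))
  have hUW : Integrable fun Z => ‖u Z‖ ^ 2 * W Z := by
    simpa only [mul_comm] using hfi hWc
  have hVUW : Integrable fun Z => V Z * ‖u Z‖ ^ 2 * W Z := by
    simpa only [mul_right_comm] using hfi (f := fun Z => V Z * W Z) (hV.continuous.mul hWc)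
  have hX : ∫ Z, m Z * ‖u Z‖ ^ 2 =
      Λ * (∫ Z, ‖u Z‖ ^ 2 * W Z) - ∫ Z, V Z * ‖u Z‖ ^ 2 * W Z := by
    rw [← integral_const_mul, ← integral_sub (hUW.const_mul Λ) hVUW]
    congr 1
    funext Z
    rw [hm_def]
    ring
  have hXb : ∫ Z, m Z * ‖u Z‖ ^ 2 ≤ b * ∫ Z, ‖u Z‖ ^ 2 * W Z := by
    rw [← integral_const_mul]
    refine integral_mono (hfi hm.continuous) (hUW.const_mul b) fun Z => ?_
    have h1 := mul_le_mul_of_nonneg_right ((abs_le.1 (hΛb Z)).2)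
      (mul_nonneg (sq_nonneg ‖u Z‖) (hW0 Z).le)
    refine le_of_eq_of_le ?_ h1
    simp only [hm_def]
    ring
  have hN : 0 ≤ ∫ Z, ‖u Z‖ ^ 2 * W Z :=
    integral_nonneg fun Z => mul_nonneg (sq_nonneg _) (hW0 Z).le
  have hinv : ∀ j l, Continuous fun Z => (g Z)⁻¹ j l := fun j l =>
    (bddLip_inv_apply hg_symm hε hG hg j l).continuous
  have hF : Integrable fun Z => (∑ j, ∑ l, (((g Z)⁻¹ j l : ℝ) : ℂ) *
      mg A p j u Z * (starRingEnd ℂ) (mg A p l u Z)) * ((W Z : ℝ) : ℂ) := by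
    refine Continuous.integrable_of_hasCompactSupport ?_ (.intro hc fun Z hZ => ?_)
    · refine .mul ?_ (Complex.continuous_ofReal.comp hWc)
      exact continuous_finsetSum _ fun j _ => continuous_finsetSum _ fun l _ =>
        ((Complex.continuous_ofReal.comp (hinv j l)).mul (continuous_mg hA hu p j)).mul
          (Complex.continuous_conj.comp (continuous_mg hA hu p l))
    · simp [mg_eq_zero_of_notMem_tsupport hZ]
  have hre : ((1 / (p : ℂ)) * ∫ Z, (∑ j, ∑ l, (((g Z)⁻¹ j l : ℝ) : ℂ) *
      mg A p j u Z * (starRingEnd ℂ) (mg A p l u Z)) * ((W Z : ℝ) : ℂ)).re =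
      1 / p * ∫ Z, ∑ j, ∑ l, h j l Z * ((mg A p j u Z).re * (mg A p l u Z).re
        + (mg A p j u Z).im * (mg A p l u Z).im) := by
    have e : (1 / (p : ℂ)) = ((1 / p : ℝ) : ℂ) := by push_cast; rfl
    have e' := integral_re hF
    simp only [RCLike.re_eq_complex_re] at e'
    rw [e, Complex.re_ofReal_mul, ← e']
    simp only [re_inner_mg, hh_def]
  have final := sub_le_of_sub_le_one_add_mul main hXb hN hr (by positivity) (by positivity) hb
  rw [hre]
  rw [hX] at final
  linarith
end
end

section
/- There exists C > 0, depending only on n, r and the matrix 𝔅, such that for every p ∈ ℕ and every v ∈ C_c^∞(ℝ^{2n}, ℂ^r): Σ_{k,ℓ=1}^{2n} ‖∇^{(p)}_k ∇^{(p)}_ℓ v‖ ≤ C (‖Δ^{(p)} v‖ + √p · (Σ_{k=1}^{2n} ‖∇^{(p)}_k v‖²)^{1/2}). -/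
open MeasureTheory Matrix

noncomputable section

/-- Magnetic covariant derivative `∇^{(p)}_j u = ∂_j u − (ip/2)(Σ_k B_{kj} Z_k) u`
for the constant-curvature model on `ℝ^{2n}`. -/
def mgd {n : ℕ} {F : Type*} [NormedAddCommGroup F] [NormedSpace ℂ F]
    (B : Matrix (Fin (2*n)) (Fin (2*n)) ℝ) (p : ℕ) (j : Fin (2*n))
    (u : (Fin (2*n) → ℝ) → F) (Z : Fin (2*n) → ℝ) : F :=
  fderiv ℝ u Z (Pi.single j 1) -
    ((Complex.I * (p : ℂ) / 2) * ∑ k, ((B k j : ℝ) : ℂ) * ((Z k : ℝ) : ℂ)) • u Z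

/-- The model Bochner Laplacian `Δ^{(p)} = −Σ_j (∇^{(p)}_j)²`. -/
def blap {n : ℕ} {F : Type*} [NormedAddCommGroup F] [NormedSpace ℂ F]
    (B : Matrix (Fin (2*n)) (Fin (2*n)) ℝ) (p : ℕ)
    (u : (Fin (2*n) → ℝ) → F) (Z : Fin (2*n) → ℝ) : F :=
  -∑ j, mgd B p j (mgd B p j u) Z

section MagneticCalculus

open scoped ContDiff

/-- The real part of the Hermitian inner product as a continuous real bilinear form. -/
def reInner (F : Type*) [NormedAddCommGroup F] [InnerProductSpace ℂ F] : F →L[ℝ] F →L[ℝ] ℝ :=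
  letI := InnerProductSpace.complexToReal (G := F)
  innerSL ℝ

variable {F : Type*} [NormedAddCommGroup F] [InnerProductSpace ℂ F]

lemma reInner_apply (x y : F) : reInner F x y = (inner ℂ x y).re := rfl

lemma reInner_self (x : F) : reInner F x x = ‖x‖ ^ 2 :=
  inner_self_eq_norm_sq (𝕜 := ℂ) x

lemma abs_reInner_le (x y : F) : |reInner F x y| ≤ ‖x‖ * ‖y‖ :=
  (Complex.abs_re_le_norm _).trans (norm_inner_le_norm x y)

/-- Multiplication by an imaginary number is skew-adjoint for the real inner product. -/
lemma reInner_I_mul_smul_left (a : ℝ) (x y : F) :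
    reInner F ((Complex.I * a) • x) y = -reInner F x ((Complex.I * a) • y) := by
  simp [reInner_apply]
  ring

/-- Smooth compactly supported functions. -/
structure IsTestFunction {E : Type*} [NormedAddCommGroup E] [NormedSpace ℝ E] (u : E → F) :
    Prop where
  contDiff : ContDiff ℝ ∞ u
  hasCompactSupport : HasCompactSupport u

namespace IsTestFunction

variable {E : Type*} [NormedAddCommGroup E] [NormedSpace ℝ E] {u w : E → F}

lemma differentiable (hu : IsTestFunction u) : Differentiable ℝ u :=
  hu.contDiff.differentiable (by simp)

lemma smul {c : E → ℂ} (hc : ContDiff ℝ ∞ c) (hu : IsTestFunction u) :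
    IsTestFunction fun x ↦ c x • u x :=
  ⟨hc.smul hu.contDiff, hu.hasCompactSupport.smul_left (f := c)⟩

lemma sub (hu : IsTestFunction u) (hw : IsTestFunction w) : IsTestFunction fun x ↦ u x - w x :=
  ⟨hu.contDiff.sub hw.contDiff, hu.hasCompactSupport.sub hw.hasCompactSupport⟩

lemma fderiv_apply (hu : IsTestFunction u) (e : E) : IsTestFunction fun x ↦ fderiv ℝ u x e :=
  ⟨(hu.contDiff.fderiv_right (m := ∞) (by simp)).clm_apply contDiff_const,
    hu.hasCompactSupport.fderiv_apply (𝕜 := ℝ) e⟩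

variable [MeasurableSpace E] [OpensMeasurableSpace E] {μ : Measure E}
  [IsFiniteMeasureOnCompacts μ]

lemma integrable_reInner (hu : IsTestFunction u) (hw : IsTestFunction w) :
    Integrable (fun x ↦ reInner F (u x) (w x)) μ := by
  refine Continuous.integrable_of_hasCompactSupport ?_ ?_
  · exact ((reInner F).continuous.comp hu.contDiff.continuous).clm_apply hw.contDiff.continuous
  · exact hu.hasCompactSupport.mono fun x hx h ↦ hx (by simp [h])

lemma integrable_norm_sq (hu : IsTestFunction u) : Integrable (fun x ↦ ‖u x‖ ^ 2) μ := by
  simpa only [reInner_self] using hu.integrable_reInner hu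

end IsTestFunction

variable {n : ℕ} (B : Matrix (Fin (2 * n)) (Fin (2 * n)) ℝ) (p : ℕ)

/-- The real potential `a_j` for which `∇_j = ∂_j − i a_j`. -/
def magneticPotential (j : Fin (2 * n)) : (Fin (2 * n) → ℝ) →L[ℝ] ℝ :=
  ∑ k, ((p : ℝ) / 2 * B k j) • ContinuousLinearMap.proj k

lemma magneticPotential_single (j k : Fin (2 * n)) :
    magneticPotential B p j (Pi.single k 1) = p / 2 * B k j := by
  simp [magneticPotential, Pi.single_apply]

lemma mgd_eq (j : Fin (2 * n)) (u : (Fin (2 * n) → ℝ) → F) (Z : Fin (2 * n) → ℝ) :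
    mgd B p j u Z = fderiv ℝ u Z (Pi.single j 1) -
      (Complex.I * (magneticPotential B p j Z : ℝ)) • u Z := by
  simp only [mgd, magneticPotential, _root_.sum_apply, _root_.smul_apply,
    ContinuousLinearMap.proj_apply, smul_eq_mul, Complex.ofReal_sum, Complex.ofReal_mul,
    Complex.ofReal_div, Complex.ofReal_natCast, Complex.ofReal_ofNat, Finset.mul_sum]
  congr 2
  exact Finset.sum_congr rfl fun k _ ↦ by ring

lemma contDiff_I_mul_clm {E : Type*} [NormedAddCommGroup E] [NormedSpace ℝ E] (a : E →L[ℝ] ℝ) :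
    ContDiff ℝ ∞ fun Z ↦ Complex.I * (a Z : ℂ) :=
  contDiff_const.mul (Complex.ofRealCLM.contDiff.comp a.contDiff)

variable {B p} {u w : (Fin (2 * n) → ℝ) → F}

lemma IsTestFunction.mgd (hu : IsTestFunction u) (j : Fin (2 * n)) :
    IsTestFunction (mgd B p j u) := by
  rw [funext (mgd_eq B p j u)]
  exact (hu.fderiv_apply _).sub (hu.smul (contDiff_I_mul_clm _))

/-- The magnetic derivatives are skew-adjoint on test functions. -/
lemma integral_reInner_mgd_left (hu : IsTestFunction u) (hw : IsTestFunction w)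
    (j : Fin (2 * n)) :
    ∫ Z, reInner F (mgd B p j u Z) (w Z) = -∫ Z, reInner F (u Z) (mgd B p j w Z) := by
  have parts := integral_bilinear_fderiv_right_eq_neg_left_of_integrable
    (μ := (volume : Measure (Fin (2 * n) → ℝ))) (v := Pi.single j 1)
    ((hu.fderiv_apply _).integrable_reInner hw) (hu.integrable_reInner (hw.fderiv_apply _))
    (hu.integrable_reInner hw) (fun x _ ↦ hu.differentiable x) (fun x _ ↦ hw.differentiable x)
  have hc := contDiff_I_mul_clm (magneticPotential B p j)
  simp only [mgd_eq, map_sub, _root_.sub_apply]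
  rw [integral_sub ((hu.fderiv_apply _).integrable_reInner hw)
      ((hu.smul hc).integrable_reInner hw),
    integral_sub (hu.integrable_reInner (hw.fderiv_apply _))
      (hu.integrable_reInner (hw.smul hc)), parts]
  simp only [reInner_I_mul_smul_left, integral_neg]
  ring

/-- Twice-iterated magnetic derivatives commute up to the curvature. -/
lemma mgd_comm (hu : IsTestFunction u) (k l : Fin (2 * n)) (Z : Fin (2 * n) → ℝ) :
    mgd B p k (mgd B p l u) Z = mgd B p l (mgd B p k u) Z +
      (Complex.I * (p / 2 * (B l k - B k l) : ℝ)) • u Z := by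
  have expand (j m : Fin (2 * n)) : fderiv ℝ (mgd B p m u) Z (Pi.single j 1) =
      fderiv ℝ (fderiv ℝ u) Z (Pi.single j 1) (Pi.single m 1) -
        ((Complex.I * (magneticPotential B p m Z : ℝ)) • fderiv ℝ u Z (Pi.single j 1) +
          (Complex.I * (p / 2 * B j m : ℝ)) • u Z) := by
    have hd : HasFDerivAt (fderiv ℝ u) (fderiv ℝ (fderiv ℝ u) Z) Z :=
      ((hu.contDiff.fderiv_right (m := ∞) (by simp)).differentiable (by simp) Z).hasFDerivAt
    have hd' := hd.clm_apply (hasFDerivAt_const (Pi.single m (1 : ℝ)) Z)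
    have hc : HasFDerivAt (fun Z ↦ Complex.I * (magneticPotential B p m Z : ℂ))
        (Complex.I • Complex.ofRealCLM.comp (magneticPotential B p m)) Z :=
      (Complex.ofRealCLM.comp (magneticPotential B p m)).hasFDerivAt.const_mul _
    have := (hd'.sub (hc.smul (hu.differentiable Z).hasFDerivAt)).fderiv
    rw [funext (mgd_eq B p m u)]
    refine (DFunLike.congr_fun this (Pi.single j 1)).trans ?_
    simp [magneticPotential_single]
  have hsymm := (hu.contDiff.contDiffAt (x := Z)).isSymmSndFDerivAt
    (by simpa using ENat.LEInfty.out)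
    (Pi.single k 1) (Pi.single l 1)
  rw [mgd_eq B p k, mgd_eq B p l (mgd B p k u), expand, expand, hsymm, mgd_eq, mgd_eq]
  push_cast
  module

lemma mgd_const_smul (hu : IsTestFunction u) (c : ℂ) (j : Fin (2 * n)) (Z : Fin (2 * n) → ℝ) :
    mgd B p j (fun Z ↦ c • u Z) Z = c • mgd B p j u Z := by
  have := ((hu.differentiable Z).hasFDerivAt.const_smul c).fderiv
  rw [mgd_eq, mgd_eq, smul_sub, smul_comm c]
  congr 1
  exact DFunLike.congr_fun this _

lemma integral_norm_sq_mgd_mgd (hu : IsTestFunction u) (k l : Fin (2 * n)) :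
    ∫ Z, ‖mgd B p k (mgd B p l u) Z‖ ^ 2 =
      (∫ Z, reInner F (mgd B p l (mgd B p l u) Z) (mgd B p k (mgd B p k u) Z)) -
        2 * ∫ Z, reInner F (mgd B p l u Z)
          ((Complex.I * (p / 2 * (B l k - B k l) : ℝ)) • mgd B p k u Z) := by
  set c : ℂ := Complex.I * (p / 2 * (B l k - B k l) : ℝ)
  have hc {w : (Fin (2 * n) → ℝ) → F} (hw : IsTestFunction w) :
      IsTestFunction fun Z ↦ c • w Z := hw.smul contDiff_const
  have hk := hu.mgd (B := B) (p := p) k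
  have hl := hu.mgd (B := B) (p := p) l
  have hkl := hl.mgd (B := B) (p := p) k
  have first : ∫ Z, ‖mgd B p k (mgd B p l u) Z‖ ^ 2 =
      (∫ Z, reInner F (mgd B p k (mgd B p l u) Z) (mgd B p l (mgd B p k u) Z)) +
        ∫ Z, reInner F (mgd B p k (mgd B p l u) Z) (c • u Z) := by
    rw [← integral_add (hkl.integrable_reInner (hk.mgd l)) (hkl.integrable_reInner (hc hu))]
    refine integral_congr_ae (.of_forall fun Z ↦ ?_)
    simp only [← map_add, ← reInner_self]
    congr 1
    exact mgd_comm hu k l Z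
  have second : ∫ Z, reInner F (mgd B p k (mgd B p l u) Z) (c • u Z) =
      -∫ Z, reInner F (mgd B p l u Z) (c • mgd B p k u Z) := by
    rw [integral_reInner_mgd_left hl (hc hu)]
    simp only [mgd_const_smul hu]
  have third : ∫ Z, reInner F (mgd B p k (mgd B p l u) Z) (mgd B p l (mgd B p k u) Z) =
      (∫ Z, reInner F (mgd B p l (mgd B p l u) Z) (mgd B p k (mgd B p k u) Z)) -
        ∫ Z, reInner F (mgd B p l u Z) (c • mgd B p k u Z) := by
    rw [integral_reInner_mgd_left hl (hk.mgd l), integral_reInner_mgd_left hl (hk.mgd k)]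
    simp only [mgd_comm hk k l, map_add]
    rw [integral_add (hl.integrable_reInner ((hk.mgd k).mgd l)) (hl.integrable_reInner (hc hk))]
    ring
  rw [first, second, third]
  ring

lemma integral_norm_sq_mgd_mgd_le (hu : IsTestFunction u) (k l : Fin (2 * n)) :
    ∫ Z, ‖mgd B p k (mgd B p l u) Z‖ ^ 2 ≤
      (∫ Z, reInner F (mgd B p l (mgd B p l u) Z) (mgd B p k (mgd B p k u) Z)) +
        |B l k - B k l| * p * ∑ j, ∫ Z, ‖mgd B p j u Z‖ ^ 2 := by
  set a : ℝ := p / 2 * (B l k - B k l)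
  set T := ∑ j, ∫ Z, ‖mgd B p j u Z‖ ^ 2
  have le_T (j : Fin (2 * n)) : ∫ Z, ‖mgd B p j u Z‖ ^ 2 ≤ T :=
    Finset.single_le_sum (f := fun j ↦ ∫ Z, ‖mgd B p j u Z‖ ^ 2)
      (fun j _ ↦ integral_nonneg fun Z ↦ by positivity) (Finset.mem_univ j)
  have hk := hu.mgd (B := B) (p := p) k
  have hl := hu.mgd (B := B) (p := p) l
  have hint := hl.integrable_norm_sq (μ := volume) |>.add (hk.integrable_norm_sq (μ := volume))
    |>.const_mul (|a| / 2)
  have bound : -(∫ Z, reInner F (mgd B p l u Z) ((Complex.I * (a : ℝ)) • mgd B p k u Z)) ≤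
      |a| / 2 * (T + T) := by
    refine (neg_le_abs _).trans ?_
    rw [← Real.norm_eq_abs]
    refine (norm_integral_le_of_norm_le hint (.of_forall fun Z ↦ ?_)).trans ?_
    · refine (abs_reInner_le _ _).trans ?_
      rw [norm_smul, norm_mul, Complex.norm_I, one_mul, Complex.norm_real, Real.norm_eq_abs]
      have := mul_nonneg (abs_nonneg a) (sq_nonneg (‖mgd B p l u Z‖ - ‖mgd B p k u Z‖))
      simp only [Pi.add_apply]
      linarith
    · rw [integral_const_mul]
      simp only [Pi.add_apply]
      rw [integral_add hl.integrable_norm_sq hk.integrable_norm_sq]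
      gcongr <;> exact le_T _
  have ha : |a| = p / 2 * |B l k - B k l| := by
    rw [abs_mul, abs_of_nonneg (by positivity)]
  rw [integral_norm_sq_mgd_mgd hu]
  rw [ha] at bound
  linarith

lemma sum_integral_reInner_mgd_mgd (hu : IsTestFunction u) :
    ∑ k, ∑ l, ∫ Z, reInner F (mgd B p l (mgd B p l u) Z) (mgd B p k (mgd B p k u) Z) =
      ∫ Z, ‖blap B p u Z‖ ^ 2 := by
  have htest (j : Fin (2 * n)) : IsTestFunction (mgd B p j (mgd B p j u)) := (hu.mgd j).mgd j
  have hint (k l : Fin (2 * n)) := (htest l).integrable_reInner (μ := volume) (htest k)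
  simp_rw [← integral_finsetSum _ fun l _ ↦ hint _ l]
  rw [← integral_finsetSum _ fun k _ ↦ integrable_finsetSum _ fun l _ ↦ hint k l]
  refine integral_congr_ae (.of_forall fun Z ↦ ?_)
  simp only [blap, norm_neg, ← reInner_self, map_sum, _root_.sum_apply]

/-- The square-integral form of the elliptic estimate. -/
lemma sum_integral_norm_sq_mgd_mgd_le (hu : IsTestFunction u) :
    ∑ k, ∑ l, ∫ Z, ‖mgd B p k (mgd B p l u) Z‖ ^ 2 ≤
      (∫ Z, ‖blap B p u Z‖ ^ 2) +
        (∑ k, ∑ l, |B l k - B k l|) * p * ∑ j, ∫ Z, ‖mgd B p j u Z‖ ^ 2 := by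
  rw [← sum_integral_reInner_mgd_mgd hu]
  simp only [Finset.sum_mul, ← Finset.sum_add_distrib]
  refine Finset.sum_le_sum fun k _ ↦ Finset.sum_le_sum fun l _ ↦ ?_
  exact integral_norm_sq_mgd_mgd_le hu k l

lemma sqrt_le_of_le_add_mul {x a k q t : ℝ} (h : x ≤ a + k * q * t) (ha : 0 ≤ a) (hk : 0 ≤ k)
    (hq : 0 ≤ q) (ht : 0 ≤ t) : √x ≤ (1 + √k) * (√a + √q * √t) := by
  refine Real.sqrt_le_iff.2 ⟨by positivity, h.trans ?_⟩
  have hroot : √a + √k * (√q * √t) ≤ (1 + √k) * (√a + √q * √t) := by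
    have : 0 ≤ √k * √a := by positivity
    have : 0 ≤ √q * √t := by positivity
    linarith
  calc a + k * q * t = √a ^ 2 + (√k * (√q * √t)) ^ 2 := by
        simp only [mul_pow, Real.sq_sqrt, ha, hk, hq, ht, mul_assoc]
    _ ≤ (√a + √k * (√q * √t)) ^ 2 := by
        have : 0 ≤ √a * (√k * (√q * √t)) := by positivity
        linarith
    _ ≤ _ := pow_le_pow_left₀ (by positivity) hroot 2

end MagneticCalculus

/-- Elliptic estimate for the model Bochner Laplacian:
`Σ_{k,ℓ} ‖∇_k ∇_ℓ v‖ ≤ C (‖Δ v‖ + √p (Σ_k ‖∇_k v‖²)^{1/2})`. -/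
theorem stmt3 (n r : ℕ) (hn : 1 ≤ n) (hr : 1 ≤ r)
    (B : Matrix (Fin (2*n)) (Fin (2*n)) ℝ) (hB : Bᵀ = -B) :
    ∃ C > 0, ∀ p : ℕ, 0 < p →
      ∀ v : (Fin (2*n) → ℝ) → EuclideanSpace ℂ (Fin r),
        ContDiff ℝ (⊤ : ℕ∞) v → HasCompactSupport v →
        ∑ k, ∑ l, Real.sqrt (∫ Z, ‖mgd B p k (mgd B p l v) Z‖ ^ 2) ≤
          C * (Real.sqrt (∫ Z, ‖blap B p v Z‖ ^ 2) +
            Real.sqrt (p : ℝ) *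
              Real.sqrt (∑ k, ∫ Z, ‖mgd B p k v Z‖ ^ 2)) := by
  set K : ℝ := ∑ k, ∑ l, |B l k - B k l|
  have hK : 0 ≤ K := by positivity
  have hN : (0 : ℝ) < (2 * n : ℕ) := by exact_mod_cast (by omega : 0 < 2 * n)
  refine ⟨(2 * n : ℕ) * ((2 * n : ℕ) * (1 + √K)), by positivity, fun p _ v hv hvs ↦ ?_⟩
  have hsum := sum_integral_norm_sq_mgd_mgd_le (B := B) (p := p) (u := v) ⟨hv, hvs⟩
  set A := ∫ Z, ‖blap B p v Z‖ ^ 2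
  set T := ∑ k, ∫ Z, ‖mgd B p k v Z‖ ^ 2
  have hA : 0 ≤ A := integral_nonneg fun Z ↦ by positivity
  have hT : 0 ≤ T := Finset.sum_nonneg fun k _ ↦ integral_nonneg fun Z ↦ by positivity
  have term (k l : Fin (2 * n)) : √(∫ Z, ‖mgd B p k (mgd B p l v) Z‖ ^ 2) ≤
      (1 + √K) * (√A + √(p : ℝ) * √T) := by
    have hnonneg (k l : Fin (2 * n)) : 0 ≤ ∫ Z, ‖mgd B p k (mgd B p l v) Z‖ ^ 2 :=
      integral_nonneg fun Z ↦ by positivity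
    have hle : ∫ Z, ‖mgd B p k (mgd B p l v) Z‖ ^ 2 ≤ A + K * p * T :=
      (Finset.single_le_sum (f := fun l ↦ ∫ Z, ‖mgd B p k (mgd B p l v) Z‖ ^ 2)
        (fun l _ ↦ hnonneg k l) (Finset.mem_univ l)).trans <|
      (Finset.single_le_sum (f := fun k ↦ ∑ l, ∫ Z, ‖mgd B p k (mgd B p l v) Z‖ ^ 2)
        (fun k _ ↦ Finset.sum_nonneg fun l _ ↦ hnonneg k l) (Finset.mem_univ k)).trans hsum
    exact sqrt_le_of_le_add_mul hle hA hK (by positivity) hT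
  refine (Finset.sum_le_sum fun k _ ↦ Finset.sum_le_sum fun l _ ↦ term k l).trans_eq ?_
  simp only [Finset.sum_const, Finset.card_univ, Fintype.card_fin, nsmul_eq_mul]
  ring
end
end

section
/- For every p ∈ ℕ and every multi-index 𝐤 = (k_1,…,k_n) ∈ ℕ^n, the set of Schwartz functions u ∈ 𝒮(ℝ^{2n}, ℂ) satisfying (1/p)Δ^{(p)} u = (Σ_{j=1}^n (2k_j + 1) a_j) · u is an infinite-dimensional complex vector subspace of 𝒮(ℝ^{2n}, ℂ); in particular, Λ_𝐤 = Σ_{j=1}^n (2k_j + 1)a_j is an eigenvalue of (1/p)Δ^{(p)} of infinite multiplicity. -/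
open MeasureTheory Matrix

noncomputable section

/-- The skew-symmetric matrix in normal form: `B_{2j−1,2j} = a_j = −B_{2j,2j−1}`
(1-based indexing), all other entries zero. -/
def Bnorm (n : ℕ) (a : Fin n → ℝ) : Matrix (Fin (2*n)) (Fin (2*n)) ℝ :=
  fun j k =>
    if h : j.val % 2 = 0 ∧ k.val = j.val + 1 then
      a ⟨j.val / 2, by have := j.isLt; omega⟩
    else if h' : k.val % 2 = 0 ∧ j.val = k.val + 1 then
      -a ⟨k.val / 2, by have := k.isLt; omega⟩
    else 0

open scoped SchwartzMap LineDeriv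

section Gaussian

variable {E : Type*} [NormedAddCommGroup E] [NormedSpace ℝ E]

/-- The function `exp (-q)` is Schwartz when `q` has temperate growth and `q x ≥ ε ‖x‖ ^ 2`. -/
theorem exists_schwartzMap_eq_exp_neg {q : E → ℝ} (hq : q.HasTemperateGrowth) {ε : ℝ}
    (hε : 0 < ε) (hqε : ∀ x, ε * ‖x‖ ^ 2 ≤ q x) :
    ∃ g : 𝓢(E, ℂ), ∀ x, g x = Complex.exp (-(q x : ℂ)) := by
  have hsmooth : ContDiff ℝ ((⊤ : ℕ∞) : WithTop ℕ∞) (Real.exp ∘ (-q)) :=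
    Real.contDiff_exp.comp hq.1.neg
  have hdecay : ∀ k n : ℕ, ∃ C : ℝ, ∀ x,
      ‖x‖ ^ k * ‖iteratedFDeriv ℝ n (Real.exp ∘ (-q)) x‖ ≤ C := by
    intro k n
    obtain ⟨K, C, hC0, hC⟩ := hq.neg.norm_iteratedFDeriv_le_uniform n
    set M : ℕ := k + K * n
    refine ⟨n.factorial * (C + 1) ^ n * Real.exp ((M : ℝ) ^ 2 / (4 * ε)), fun x ↦ ?_⟩
    have hx : 0 ≤ ‖x‖ := norm_nonneg x
    have hbase : 1 ≤ (C + 1) * (1 + ‖x‖) ^ K :=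
      one_le_mul_of_one_le_of_one_le (by linarith) (one_le_pow₀ (by linarith))
    have hder : ‖iteratedFDeriv ℝ n (Real.exp ∘ (-q)) x‖ ≤
        n.factorial * Real.exp (-q x) * ((C + 1) * (1 + ‖x‖) ^ K) ^ n := by
      refine norm_iteratedFDeriv_comp_le (N := n) Real.contDiff_exp
        (hq.neg.1.of_le (mod_cast le_top)) le_rfl x (fun i _ ↦ ?_) fun i hi hin ↦ ?_
      · rw [norm_iteratedFDeriv_eq_norm_iteratedDeriv, iteratedDeriv_eq_iterate,
          Real.iter_deriv_exp]
        simp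
      · calc _ ≤ C * (1 + ‖x‖) ^ K := hC i hin x
          _ ≤ (C + 1) * (1 + ‖x‖) ^ K := by gcongr; linarith
          _ ≤ _ := le_self_pow₀ hbase (by omega)
    have hpow : (1 + ‖x‖) ^ M ≤ Real.exp (M * ‖x‖) := by
      rw [Real.exp_nat_mul]
      gcongr
      linarith [Real.add_one_le_exp ‖x‖]
    have hexp : Real.exp (M * ‖x‖) * Real.exp (-q x) ≤ Real.exp ((M : ℝ) ^ 2 / (4 * ε)) := by
      rw [← Real.exp_add]
      gcongr
      have h1 : (M : ℝ) * ‖x‖ - ε * ‖x‖ ^ 2 ≤ (M : ℝ) ^ 2 / (4 * ε) := by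
        rw [le_div_iff₀ (by positivity)]
        nlinarith [sq_nonneg (2 * ε * ‖x‖ - M)]
      linarith [hqε x]
    calc ‖x‖ ^ k * ‖iteratedFDeriv ℝ n (Real.exp ∘ (-q)) x‖
        ≤ (1 + ‖x‖) ^ k *
          (n.factorial * Real.exp (-q x) * ((C + 1) * (1 + ‖x‖) ^ K) ^ n) := by
          gcongr; linarith
      _ = n.factorial * (C + 1) ^ n * ((1 + ‖x‖) ^ M * Real.exp (-q x)) := by
          rw [mul_pow, ← pow_mul, pow_add]; ring
      _ ≤ n.factorial * (C + 1) ^ n * (Real.exp (M * ‖x‖) * Real.exp (-q x)) := by gcongr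
      _ ≤ _ := by gcongr
  refine ⟨SchwartzMap.postcompCLM Complex.ofRealCLM
    (⟨Real.exp ∘ (-q), hsmooth, hdecay⟩ : 𝓢(E, ℝ)), fun x ↦ ?_⟩
  change ((Real.exp (-q x) : ℝ) : ℂ) = _
  push_cast
  rfl

end Gaussian

section CovariantDerivative

variable {E : Type*} [NormedAddCommGroup E] [NormedSpace ℝ E]

/-- The operator `u ↦ ∂_v u - ℓ u` on Schwartz functions, for a linear form `ℓ`. -/
def covDeriv (v : E) (ℓ : E →L[ℝ] ℂ) : Module.End ℂ 𝓢(E, ℂ) :=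
  ((LineDeriv.lineDerivOpCLM ℂ 𝓢(E, ℂ) v - SchwartzMap.smulLeftCLM ℂ (⇑ℓ) :
    𝓢(E, ℂ) →L[ℂ] 𝓢(E, ℂ)) : 𝓢(E, ℂ) →ₗ[ℂ] 𝓢(E, ℂ))

theorem covDeriv_apply (v : E) (ℓ : E →L[ℝ] ℂ) (u : 𝓢(E, ℂ)) (x : E) :
    covDeriv v ℓ u x = fderiv ℝ u x v - ℓ x * u x := by
  simp [covDeriv, SchwartzMap.lineDerivOp_apply_eq_fderiv,
    SchwartzMap.smulLeftCLM_apply_apply ℓ.hasTemperateGrowth]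

theorem fderiv_covDeriv_apply (v w : E) (ℓ : E →L[ℝ] ℂ) (u : 𝓢(E, ℂ)) (x : E) :
    fderiv ℝ (covDeriv v ℓ u) x w =
      fderiv ℝ (fderiv ℝ u) x w v - (ℓ x * fderiv ℝ u x w + ℓ w * u x) := by
  have hcoe : ⇑(covDeriv v ℓ u) = fun x ↦ fderiv ℝ u x v - ℓ x * u x :=
    funext fun x ↦ covDeriv_apply v ℓ u x
  have h2 : DifferentiableAt ℝ (fderiv ℝ u) x :=
    (SchwartzMap.fderivCLM ℝ E ℂ u).differentiableAt
  have h3 := (h2.hasFDerivAt.clm_apply (hasFDerivAt_const v x)).sub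
    (ℓ.hasFDerivAt.mul (u.hasFDerivAt x))
  rw [hcoe]
  erw [h3.fderiv]
  simp [mul_comm]

theorem covDeriv_mul_sub_mul (v w : E) (ℓ m : E →L[ℝ] ℂ) :
    covDeriv v ℓ * covDeriv w m - covDeriv w m * covDeriv v ℓ = (ℓ w - m v) • 1 := by
  ext u x
  have hsymm : fderiv ℝ (fderiv ℝ u) x v w = fderiv ℝ (fderiv ℝ u) x w v :=
    ((u.contDiffAt 2).isSymmSndFDerivAt (by simp)) v w
  simp only [LinearMap.sub_apply, _root_.sub_apply, Module.End.mul_apply,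
    LinearMap.smul_apply, _root_.smul_apply, Module.End.one_apply, smul_eq_mul]
  rw [covDeriv_apply v _ (covDeriv w m u), covDeriv_apply w _ (covDeriv v ℓ u),
    fderiv_covDeriv_apply, fderiv_covDeriv_apply, covDeriv_apply v, covDeriv_apply w, hsymm]
  ring

end CovariantDerivative

section Algebra

variable {V : Type*} [AddCommGroup V] [Module ℂ V]

/-- A nonzero subspace invariant under two operators whose commutator is a nonzero scalar is
infinite-dimensional. -/
theorem not_finiteDimensional_of_commutator_eq_smul_one {S : Submodule ℂ V} {P Q : Module.End ℂ V}
    {c : ℂ} (hc : c ≠ 0) (hPQ : P * Q - Q * P = c • 1) (hP : ∀ u ∈ S, P u ∈ S)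
    (hQ : ∀ u ∈ S, Q u ∈ S) {u : V} (huS : u ∈ S) (hu : u ≠ 0) : ¬ FiniteDimensional ℂ S := by
  intro hfin
  have hcomm : P.restrict hP * Q.restrict hQ - Q.restrict hQ * P.restrict hP =
      c • (1 : Module.End ℂ S) := by
    ext x
    simpa using LinearMap.congr_fun hPQ (x : V)
  have htr := congrArg (LinearMap.trace ℂ S) hcomm
  rw [map_sub, LinearMap.trace_mul_comm, sub_self, map_smul, LinearMap.trace_one, smul_eq_mul,
    eq_comm, mul_eq_zero, or_iff_right hc, Nat.cast_eq_zero] at htr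
  have := (Submodule.finrank_eq_zero.mp htr) ▸ huS
  exact hu (by simpa using this)

/-- Ladder operators acting on a common vacuum vector produce simultaneous eigenvectors of the
number operators `C m * A m`. -/
theorem exists_simultaneous_eigenvector_of_ladder {ι : Type*} [Finite ι] {A C : ι → Module.End ℂ V}
    {c : ι → ℝ} (hc : ∀ m, 0 < c m) (hAC : ∀ m, A m * C m - C m * A m = (c m : ℂ) • 1)
    (hAC' : ∀ m l, m ≠ l → Commute (A m) (C l)) (hCC : ∀ m l, Commute (C m) (C l))
    {g : V} (hg : g ≠ 0) (hAg : ∀ m, A m g = 0) (k : ι → ℕ) :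
    ∃ u : V, u ≠ 0 ∧ ∀ m, C m (A m u) = ((c m * k m : ℝ) : ℂ) • u := by
  classical
  have := Fintype.ofFinite ι
  induction hN : ∑ m, k m generalizing k with
  | zero =>
    have hk : ∀ m, k m = 0 := by simpa using hN
    exact ⟨g, hg, fun m ↦ by simp [hAg, hk]⟩
  | succ N ih =>
    obtain ⟨l, hl⟩ : ∃ l, k l ≠ 0 := by
      by_contra! h
      simp [h] at hN
    obtain ⟨j, hj⟩ := Nat.exists_eq_succ_of_ne_zero hl
    have hsum := Finset.sum_update_of_mem (Finset.mem_univ l) k j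
    have hsum' := Finset.add_sum_erase Finset.univ k (Finset.mem_univ l)
    rw [Finset.sdiff_singleton_eq_erase] at hsum
    obtain ⟨u, hu, huk⟩ := ih (Function.update k l j) (by omega)
    have hACl (m : ι) (x : V) : A m (C m x) = C m (A m x) + (c m : ℂ) • x := by
      simpa [sub_eq_iff_eq_add'] using LinearMap.congr_fun (hAC m) x
    have hraise : A l (C l u) = ((c l * k l : ℝ) : ℂ) • u := by
      rw [hACl, huk, Function.update_self, ← add_smul, hj]
      push_cast
      congr 1
      ring
    refine ⟨C l u, fun h0 ↦ ?_, fun m ↦ ?_⟩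
    · rw [h0, map_zero, eq_comm, smul_eq_zero, or_iff_left hu] at hraise
      have : c l * k l ≠ 0 := mul_ne_zero (hc l).ne' (by exact_mod_cast hl)
      exact this (by exact_mod_cast hraise)
    · rcases eq_or_ne m l with rfl | hml
      · rw [hraise, map_smul]
      · have h1 : A m (C l u) = C l (A m u) := LinearMap.congr_fun (hAC' m l hml) u
        have h2 : C m (C l (A m u)) = C l (C m (A m u)) := LinearMap.congr_fun (hCC m l) _
        rw [h1, h2, huk, map_smul, Function.update_of_ne hml]

end Algebra

section Magnetic

variable {n : ℕ}

/-- The linear form `Z ↦ (ip/2) Σ_k B_{kj} Z_k`. -/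
def magForm (B : Matrix (Fin (2*n)) (Fin (2*n)) ℝ) (p : ℕ) (j : Fin (2*n)) :
    (Fin (2*n) → ℝ) →L[ℝ] ℂ :=
  ∑ k, ((Complex.I * (p : ℂ) / 2) * (B k j : ℂ)) •
    (Complex.ofRealCLM.comp (ContinuousLinearMap.proj k))

theorem magForm_apply (B : Matrix (Fin (2*n)) (Fin (2*n)) ℝ) (p : ℕ) (j : Fin (2*n))
    (Z : Fin (2*n) → ℝ) :
    magForm B p j Z = (Complex.I * (p : ℂ) / 2) * ∑ k, (B k j : ℂ) * (Z k : ℂ) := by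
  simp [magForm, Finset.mul_sum, mul_assoc]

theorem magForm_single (B : Matrix (Fin (2*n)) (Fin (2*n)) ℝ) (p : ℕ) (j k : Fin (2*n)) :
    magForm B p j (Pi.single k 1) = (Complex.I * (p : ℂ) / 2) * (B k j : ℂ) := by
  rw [magForm_apply, Finset.sum_eq_single k] <;> simp +contextual

/-- The magnetic covariant derivative as an operator on Schwartz space. -/
def magDeriv (B : Matrix (Fin (2*n)) (Fin (2*n)) ℝ) (p : ℕ) (j : Fin (2*n)) :
    Module.End ℂ 𝓢(Fin (2*n) → ℝ, ℂ) :=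
  covDeriv (Pi.single j 1) (magForm B p j)

/-- The covariant derivative for the opposite magnetic field; it commutes with `magDeriv`. -/
def dualMagDeriv (B : Matrix (Fin (2*n)) (Fin (2*n)) ℝ) (p : ℕ) (j : Fin (2*n)) :
    Module.End ℂ 𝓢(Fin (2*n) → ℝ, ℂ) :=
  covDeriv (Pi.single j 1) (-magForm B p j)

/-- The Bochner Laplacian as an operator on Schwartz space. -/
def bochnerLaplacian (B : Matrix (Fin (2*n)) (Fin (2*n)) ℝ) (p : ℕ) :
    Module.End ℂ 𝓢(Fin (2*n) → ℝ, ℂ) :=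
  -∑ j, magDeriv B p j * magDeriv B p j

theorem mgd_coe (B : Matrix (Fin (2*n)) (Fin (2*n)) ℝ) (p : ℕ) (j : Fin (2*n))
    (u : 𝓢(Fin (2*n) → ℝ, ℂ)) : mgd B p j u = magDeriv B p j u := by
  ext Z
  rw [magDeriv, covDeriv_apply, magForm_apply, mgd, smul_eq_mul]

theorem blap_coe (B : Matrix (Fin (2*n)) (Fin (2*n)) ℝ) (p : ℕ)
    (u : 𝓢(Fin (2*n) → ℝ, ℂ)) : blap B p u = bochnerLaplacian B p u := by
  ext Z
  simp [blap, mgd_coe, bochnerLaplacian]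

variable {B : Matrix (Fin (2*n)) (Fin (2*n)) ℝ}

theorem magDeriv_commutator (hB : ∀ j k, B j k = -B k j) (p : ℕ) (j k : Fin (2*n)) :
    magDeriv B p j * magDeriv B p k - magDeriv B p k * magDeriv B p j =
      (-(Complex.I * p * B j k)) • 1 := by
  rw [magDeriv, magDeriv, covDeriv_mul_sub_mul, magForm_single, magForm_single, hB k j]
  congr 1
  push_cast
  ring

theorem dualMagDeriv_commutator (hB : ∀ j k, B j k = -B k j) (p : ℕ) (j k : Fin (2*n)) :
    dualMagDeriv B p j * dualMagDeriv B p k - dualMagDeriv B p k * dualMagDeriv B p j =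
      (Complex.I * p * B j k) • 1 := by
  rw [dualMagDeriv, dualMagDeriv, covDeriv_mul_sub_mul, _root_.neg_apply,
    _root_.neg_apply, magForm_single, magForm_single, hB k j]
  congr 1
  push_cast
  ring

theorem commute_dualMagDeriv_magDeriv (hB : ∀ j k, B j k = -B k j) (p : ℕ) (j k : Fin (2*n)) :
    Commute (dualMagDeriv B p j) (magDeriv B p k) := by
  refine sub_eq_zero.mp ?_
  rw [dualMagDeriv, magDeriv, covDeriv_mul_sub_mul, _root_.neg_apply,
    magForm_single, magForm_single, hB k j]
  simp

theorem commute_dualMagDeriv_bochnerLaplacian (hB : ∀ j k, B j k = -B k j) (p : ℕ)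
    (j : Fin (2*n)) :
    Commute (dualMagDeriv B p j) (bochnerLaplacian B p) :=
  (Commute.sum_right _ _ _ fun k _ ↦ (commute_dualMagDeriv_magDeriv hB p j k).mul_right
    (commute_dualMagDeriv_magDeriv hB p j k)).neg_right

end Magnetic

section NormalForm

variable {n : ℕ}

/-- The index `2m` (the first coordinate of the `m`-th plane, counting from `0`). -/
def fstIdx (m : Fin n) : Fin (2*n) := ⟨2 * m, by omega⟩

/-- The index `2m + 1` (the second coordinate of the `m`-th plane, counting from `0`). -/
def sndIdx (m : Fin n) : Fin (2*n) := ⟨2 * m + 1, by omega⟩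

theorem fstIdx_val (m : Fin n) : (fstIdx m).val = 2 * m := rfl

theorem sndIdx_val (m : Fin n) : (sndIdx m).val = 2 * m + 1 := rfl

theorem sum_eq_sum_fstIdx_add_sndIdx {M : Type*} [AddCommMonoid M] (f : Fin (2*n) → M) :
    ∑ j, f j = ∑ m, (f (fstIdx m) + f (sndIdx m)) := by
  rw [← (finProdFinEquiv.trans (finCongr (Nat.mul_comm n 2))).sum_comp, Fintype.sum_prod_type]
  refine Finset.sum_congr rfl fun m _ ↦ ?_
  rw [Fin.sum_univ_two]
  congr 2 <;> ext <;> simp [fstIdx, sndIdx, add_comm]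

theorem Bnorm_antisymm (a : Fin n → ℝ) (j k : Fin (2*n)) : Bnorm n a j k = -Bnorm n a k j := by
  unfold Bnorm
  split_ifs <;> first | omega | simp

theorem Bnorm_fst_fst (a : Fin n → ℝ) (m l : Fin n) : Bnorm n a (fstIdx m) (fstIdx l) = 0 := by
  rw [Bnorm, dif_neg (by simp only [fstIdx_val]; omega), dif_neg (by simp only [fstIdx_val]; omega)]

theorem Bnorm_snd_snd (a : Fin n → ℝ) (m l : Fin n) : Bnorm n a (sndIdx m) (sndIdx l) = 0 := by
  rw [Bnorm, dif_neg (by simp only [sndIdx_val]; omega), dif_neg (by simp only [sndIdx_val]; omega)]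

theorem Bnorm_fst_snd (a : Fin n → ℝ) (m l : Fin n) :
    Bnorm n a (fstIdx m) (sndIdx l) = if m = l then a m else 0 := by
  rcases eq_or_ne m l with rfl | hml
  · simp [Bnorm, fstIdx, sndIdx]
  · rw [Bnorm, dif_neg (by simp only [fstIdx_val, sndIdx_val]; omega),
      dif_neg (by simp only [fstIdx_val, sndIdx_val]; omega), if_neg hml]

theorem Bnorm_snd_fst (a : Fin n → ℝ) (m l : Fin n) :
    Bnorm n a (sndIdx m) (fstIdx l) = if m = l then -a m else 0 := by
  rw [Bnorm_antisymm, Bnorm_fst_snd]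
  split_ifs <;> simp_all

variable (a : Fin n → ℝ) (p : ℕ)

/-- The annihilation operator of the `m`-th plane. -/
def lowering (m : Fin n) : Module.End ℂ 𝓢(Fin (2*n) → ℝ, ℂ) :=
  magDeriv (Bnorm n a) p (fstIdx m) + Complex.I • magDeriv (Bnorm n a) p (sndIdx m)

/-- The creation operator of the `m`-th plane. -/
def raising (m : Fin n) : Module.End ℂ 𝓢(Fin (2*n) → ℝ, ℂ) :=
  -(magDeriv (Bnorm n a) p (fstIdx m) - Complex.I • magDeriv (Bnorm n a) p (sndIdx m))

theorem lowering_raising_commutator (m l : Fin n) :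
    lowering a p m * raising a p l - raising a p l * lowering a p m =
      (if m = l then 2 * p * a m else 0 : ℂ) • 1 := by
  have h := magDeriv_commutator (Bnorm_antisymm a) p
  have hff := h (fstIdx m) (fstIdx l)
  have hfs := h (fstIdx m) (sndIdx l)
  have hsf := h (sndIdx m) (fstIdx l)
  have hss := h (sndIdx m) (sndIdx l)
  rw [Bnorm_fst_fst] at hff
  rw [Bnorm_fst_snd] at hfs
  rw [Bnorm_snd_fst] at hsf
  rw [Bnorm_snd_snd] at hss
  rw [sub_eq_iff_eq_add] at hff hfs hsf hss
  simp only [lowering, raising, mul_sub, sub_mul, add_mul, mul_add, mul_neg, neg_mul,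
    smul_mul_assoc, mul_smul_comm, hff, hfs, hsf, hss]
  split_ifs
  · push_cast
    match_scalars <;> (simp; try (ring_nf; simp))
  · push_cast
    match_scalars <;> simp

theorem commute_raising (m l : Fin n) : Commute (raising a p m) (raising a p l) := by
  have h := magDeriv_commutator (Bnorm_antisymm a) p
  have hff := h (fstIdx m) (fstIdx l)
  have hfs := h (fstIdx m) (sndIdx l)
  have hsf := h (sndIdx m) (fstIdx l)
  have hss := h (sndIdx m) (sndIdx l)
  rw [Bnorm_fst_fst] at hff
  rw [Bnorm_fst_snd] at hfs
  rw [Bnorm_snd_fst] at hsf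
  rw [Bnorm_snd_snd] at hss
  rw [sub_eq_iff_eq_add] at hff hfs hsf hss
  refine sub_eq_zero.mp ?_
  simp only [raising, mul_sub, sub_mul, mul_neg, neg_mul,
    smul_mul_assoc, mul_smul_comm, hff, hfs, hsf, hss]
  split_ifs <;> push_cast <;> match_scalars <;> simp

theorem bochnerLaplacian_eq_sum_raising_mul_lowering :
    bochnerLaplacian (Bnorm n a) p =
      ∑ m, (raising a p m * lowering a p m + (p * a m : ℂ) • 1) := by
  rw [bochnerLaplacian, sum_eq_sum_fstIdx_add_sndIdx, ← Finset.sum_neg_distrib]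
  refine Finset.sum_congr rfl fun m _ ↦ ?_
  have h := magDeriv_commutator (Bnorm_antisymm a) p (fstIdx m) (sndIdx m)
  rw [Bnorm_fst_snd, if_pos rfl, sub_eq_iff_eq_add] at h
  simp only [lowering, raising, sub_mul, mul_add, neg_mul, smul_mul_assoc, mul_smul_comm, h]
  match_scalars <;> (simp; try (ring_nf; simp))

theorem magForm_fstIdx (m : Fin n) (Z : Fin (2*n) → ℝ) :
    magForm (Bnorm n a) p (fstIdx m) Z = -(Complex.I * p * a m / 2 * Z (sndIdx m)) := by
  rw [magForm_apply, sum_eq_sum_fstIdx_add_sndIdx, Finset.sum_eq_single m]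
  · rw [Bnorm_fst_fst, Bnorm_snd_fst, if_pos rfl]
    push_cast
    ring
  · intro l _ hl
    simp [Bnorm_fst_fst, Bnorm_snd_fst, hl]
  · simp

theorem magForm_sndIdx (m : Fin n) (Z : Fin (2*n) → ℝ) :
    magForm (Bnorm n a) p (sndIdx m) Z = Complex.I * p * a m / 2 * Z (fstIdx m) := by
  rw [magForm_apply, sum_eq_sum_fstIdx_add_sndIdx, Finset.sum_eq_single m]
  · rw [Bnorm_snd_snd, Bnorm_fst_snd, if_pos rfl]
    push_cast
    ring
  · intro l _ hl
    simp [Bnorm_snd_snd, Bnorm_fst_snd, hl]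
  · simp

variable {a p}

/-- The lowest Landau level contains a Gaussian. -/
theorem exists_vacuum (ha : ∀ j, 0 < a j) (hp : 0 < p) :
    ∃ g : 𝓢(Fin (2*n) → ℝ, ℂ), g ≠ 0 ∧ ∀ m, lowering a p m g = 0 := by
  set w : Fin (2*n) → ℝ := fun j ↦ p * a ⟨j / 2, by omega⟩ / 4 with hw
  have hw0 (j) : 0 < w j := by have := ha ⟨j / 2, by omega⟩; positivity
  set q : (Fin (2*n) → ℝ) → ℝ := fun Z ↦ ∑ j, w j * Z j ^ 2 with hq
  have hqt : q.HasTemperateGrowth := by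
    refine Function.HasTemperateGrowth.sum fun j _ ↦ ?_
    have h1 : (fun Z : Fin (2*n) → ℝ ↦ Z j).HasTemperateGrowth :=
      (ContinuousLinearMap.proj (R := ℝ) (φ := fun _ : Fin (2*n) ↦ ℝ) j).hasTemperateGrowth
    exact (Function.HasTemperateGrowth.const (w j)).mul (h1.pow 2)
  obtain ⟨ε, hε, hεw⟩ : ∃ ε > 0, ∀ j, ε ≤ w j := by
    rcases isEmpty_or_nonempty (Fin (2*n)) with h | h
    · exact ⟨1, one_pos, fun j ↦ h.elim j⟩
    · obtain ⟨i, hi⟩ := Finite.exists_min w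
      exact ⟨w i, hw0 i, hi⟩
  have hqε (Z) : ε * ‖Z‖ ^ 2 ≤ q Z := by
    have hsum (j) : w j * Z j ^ 2 ≤ q Z :=
      Finset.single_le_sum (f := fun j ↦ w j * Z j ^ 2)
        (fun i _ ↦ mul_nonneg (hw0 i).le (sq_nonneg _)) (Finset.mem_univ j)
    have hq0 : 0 ≤ q Z := Finset.sum_nonneg fun i _ ↦ mul_nonneg (hw0 i).le (sq_nonneg _)
    have hnorm : ‖Z‖ ≤ √(q Z / ε) := by
      refine (pi_norm_le_iff_of_nonneg (Real.sqrt_nonneg _)).mpr fun j ↦ ?_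
      refine Real.abs_le_sqrt ((le_div_iff₀' hε).mpr ?_)
      exact (mul_le_mul_of_nonneg_right (hεw j) (sq_nonneg _)).trans (hsum j)
    rw [← le_div_iff₀' hε]
    exact (Real.le_sqrt (norm_nonneg _) (by positivity)).mp hnorm
  obtain ⟨g, hg⟩ := exists_schwartzMap_eq_exp_neg hqt hε hqε
  have hder (Z : Fin (2*n) → ℝ) (j) :
      fderiv ℝ g Z (Pi.single j 1) = -(2 * w j * Z j) * g Z := by
    have hqd : HasFDerivAt q (∑ i, w i • ((2 * Z i) •
        ContinuousLinearMap.proj (R := ℝ) (φ := fun _ : Fin (2*n) ↦ ℝ) i)) Z := by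
      refine HasFDerivAt.fun_sum fun i _ ↦ ?_
      simpa using ((hasFDerivAt_apply (𝕜 := ℝ) i Z).pow 2).const_mul (w i)
    have h2 := (Complex.ofRealCLM.hasFDerivAt.comp Z hqd).neg.cexp
    have hgc : ⇑g = fun Z ↦ Complex.exp (-(q Z : ℂ)) := funext hg
    rw [hgc, HasFDerivAt.fderiv (f := fun Z ↦ Complex.exp (-(q Z : ℂ))) h2,
      _root_.smul_apply, _root_.neg_apply, ContinuousLinearMap.comp_apply, _root_.sum_apply,
      Finset.sum_eq_single j]
    · simp
      ring
    · intro i _ hi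
      simp [hi]
    · simp
  refine ⟨g, fun h0 ↦ ?_, fun m ↦ ?_⟩
  · have := hg 0
    rw [h0, _root_.zero_apply] at this
    exact Complex.exp_ne_zero _ this.symm
  · ext Z
    have hwf : w (fstIdx m) = p * a m / 4 := by
      simp [hw, fstIdx]
    have hws : w (sndIdx m) = p * a m / 4 := by
      simp only [hw, sndIdx]
      congr 4
      omega
    simp only [lowering, LinearMap.add_apply, LinearMap.smul_apply,
      _root_.add_apply, _root_.smul_apply, magDeriv, covDeriv_apply, hder, hwf, hws,
      magForm_fstIdx, magForm_sndIdx, smul_eq_mul,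
      _root_.zero_apply]
    push_cast
    linear_combination (-(p * a m / 2 * Z (fstIdx m) * g Z) : ℂ) * Complex.I_sq

end NormalForm

/-- Each Landau level `Λ_k = Σ_j (2k_j + 1)a_j` is an eigenvalue of `(1/p)Δ^{(p)}`
of infinite multiplicity: the corresponding eigenspace inside the Schwartz space
is an infinite-dimensional complex vector subspace. -/
theorem stmt9 (n : ℕ) (hn : 1 ≤ n)
    (a : Fin n → ℝ) (ha : ∀ j, 0 < a j)
    (p : ℕ) (hp : 0 < p) (kk : Fin n → ℕ) :
    ∃ S : Submodule ℂ (SchwartzMap (Fin (2*n) → ℝ) ℂ),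
      (S : Set (SchwartzMap (Fin (2*n) → ℝ) ℂ)) =
        {u : SchwartzMap (Fin (2*n) → ℝ) ℂ | ∀ Z, (1 / (p : ℂ)) * blap (Bnorm n a) p (⇑u) Z =
          ((∑ j, (2 * (kk j : ℝ) + 1) * a j : ℝ) : ℂ) * u Z} ∧
      ¬ FiniteDimensional ℂ S := by
  have hp' : (p : ℂ) ≠ 0 := by exact_mod_cast hp.ne'
  set Λ : ℂ := ((∑ j, (2 * (kk j : ℝ) + 1) * a j : ℝ) : ℂ) with hΛ
  set H := (1 / (p : ℂ)) • bochnerLaplacian (Bnorm n a) p with hH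
  refine ⟨Module.End.eigenspace H Λ, ?_, ?_⟩
  · ext u
    rw [SetLike.mem_coe, Module.End.mem_eigenspace_iff, Set.mem_ofPred_eq, blap_coe,
      DFunLike.ext_iff]
    simp [hH]
  · have hinv (j : Fin (2*n)) (u) (hu : u ∈ Module.End.eigenspace H Λ) :
        dualMagDeriv (Bnorm n a) p j u ∈ Module.End.eigenspace H Λ := by
      have hcomm : Commute (dualMagDeriv (Bnorm n a) p j) H :=
        (commute_dualMagDeriv_bochnerLaplacian (Bnorm_antisymm a) p j).smul_right _
      rw [Module.End.mem_eigenspace_iff] at hu ⊢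
      rw [← Module.End.mul_apply, ← hcomm.eq, Module.End.mul_apply, hu, map_smul]
    have hpa (m) : 0 < 2 * p * a m := mul_pos (by positivity) (ha m)
    obtain ⟨g, hg, hAg⟩ := exists_vacuum ha hp
    obtain ⟨u, hu, huk⟩ := exists_simultaneous_eigenvector_of_ladder (A := lowering a p)
      (C := raising a p) hpa
      (fun m ↦ by rw [lowering_raising_commutator, if_pos rfl]; push_cast; rfl)
      (fun m l hml ↦ sub_eq_zero.mp (by rw [lowering_raising_commutator, if_neg hml, zero_smul]))
      (commute_raising a p) hg hAg kk
    let m₀ : Fin n := ⟨0, hn⟩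
    refine not_finiteDimensional_of_commutator_eq_smul_one (u := u) ?_
      (dualMagDeriv_commutator (Bnorm_antisymm a) p (fstIdx m₀) (sndIdx m₀))
      (hinv _) (hinv _) ?_ hu
    · rw [Bnorm_fst_snd, if_pos rfl]
      have : (a m₀ : ℂ) ≠ 0 := by exact_mod_cast (ha m₀).ne'
      simp [hp', this]
    · rw [Module.End.mem_eigenspace_iff, hH, bochnerLaplacian_eq_sum_raising_mul_lowering]
      simp only [LinearMap.smul_apply, LinearMap.sum_apply, LinearMap.add_apply,
        Module.End.mul_apply, huk, Module.End.one_apply, ← add_smul, ← Finset.sum_smul, smul_smul, hΛ]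
      congr 1
      push_cast
      rw [Finset.mul_sum]
      refine Finset.sum_congr rfl fun m _ ↦ ?_
      field_simp
end
end
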